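/- For every integer k ≥ 3 there exists a nonzero homogeneous polynomial P ∈ ℝ[x₀,x₁,x₂] of degree 2k, squarefree over ℂ, such that ℝZ(P) = {[x] ∈ ℙ²(ℝ) : P(x) = 0} is finite and |ℝZ(P)| = 12l² − 4l + 2 if k = 3l, |ℝZ(P)| = 12l² + 4l + 3 if k = 3l + 1, and |ℝZ(P)| = 12l² + 12l + 6 if k = 3l + 2 (l ∈ ℤ≥0). -/

import Mathlib

open MvPolynomial

/-- The real projective zero set of a homogeneous polynomial in three variables. -/
noncomputable def RZ (P : MvPolynomial (Fin 3) ℝ) : Set (Projectivization ℝ (Fin 3 → ℝ)) :=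
  {x | MvPolynomial.eval x.rep P = 0}

namespace FC

/-- The extremal principle. -/
theorem extremal {E κ : Type*} [Fintype κ] [DecidableEq κ] (A : E → ℝ) (M : κ → E → ℝ)
    (C K δ : ℝ) (hC : 0 < C) (hA : ∀ x, 0 ≤ A x) (hM : ∀ β x, 0 ≤ M β x) (hK0 : 0 < K)
    (hK : C * Fintype.card κ ≤ K) (hδ : 0 ≤ δ) (hδ1 : δ * Fintype.card κ < 1)
    (hδ2 : C * δ * Fintype.card κ ≤ 1 / 2)
    (ha : ∀ β x, A x ≤ K * M β x → 0 < M β x → ∀ γ, γ ≠ β → M γ x ≤ δ * M β x)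
    (hb : ∀ β x, A x ≤ K * M β x → 0 < M β x → M β x ≤ A x)
    (hc : ∀ β, ∃ x, 0 < M β x ∧ A x < C * M β x)
    (hd : ∀ β (c : κ → ℝ), (∀ x, A x ≤ K * M β x → 0 < M β x → 0 < A x - ∑ γ, c γ * M γ x) →
      ∃ m, 0 < m ∧ ∀ x, A x ≤ K * M β x → 0 < M β x → m * M β x ≤ A x - ∑ γ, c γ * M γ x) :
    ∃ c : κ → ℝ, (∀ β, 0 ≤ c β) ∧ (∀ β, c β ≤ C) ∧ (∀ x, 0 ≤ A x - ∑ γ, c γ * M γ x) ∧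
      ∀ β, ∃ x, A x ≤ K * M β x ∧ 0 < M β x ∧ A x - ∑ γ, c γ * M γ x = 0 := by
  classical
  set S : Set (κ → ℝ) := Set.Icc (fun _ => 0) (fun _ => C) ∩
    {c | ∀ x, 0 ≤ A x - ∑ γ, c γ * M γ x} with hS
  have hScomp : IsCompact S := by
    apply IsCompact.inter_right isCompact_Icc
    rw [Set.ofPred_forall]
    apply isClosed_iInter
    intro x
    exact isClosed_le continuous_const (by fun_prop)
  have hSne : S.Nonempty := by
    refine ⟨fun _ => 0, ⟨⟨le_refl _, fun _ => hC.le⟩, ?_⟩⟩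
    intro x
    simpa using hA x
  obtain ⟨c, hcS, hmax⟩ := hScomp.exists_isMaxOn hSne
    (f := fun c : κ → ℝ => ∑ γ, c γ) (by fun_prop)
  have h0 : ∀ β, 0 ≤ c β := fun β => hcS.1.1 β
  have h1 : ∀ β, c β ≤ C := fun β => hcS.1.2 β
  have h2 : ∀ x, 0 ≤ A x - ∑ γ, c γ * M γ x := hcS.2
  refine ⟨c, h0, h1, h2, ?_⟩
  intro β
  by_contra hno
  push Not at hno
  have hpos : ∀ x, A x ≤ K * M β x → 0 < M β x → 0 < A x - ∑ γ, c γ * M γ x := by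
    intro x hx hx'
    exact lt_of_le_of_ne (h2 x) (Ne.symm (hno x hx hx'))
  obtain ⟨m, hm, hmm⟩ := hd β c hpos
  -- c β < C
  have hlt : c β < C := by
    obtain ⟨x, hx1, hx2⟩ := hc β
    have h3 : c β * M β x ≤ ∑ γ, c γ * M γ x :=
      Finset.single_le_sum (f := fun γ => c γ * M γ x)
        (fun γ _ => mul_nonneg (h0 γ) (hM γ x)) (Finset.mem_univ β)
    have h4 := h2 x
    have : c β * M β x < C * M β x := by linarith
    exact lt_of_mul_lt_mul_right this hx1.le
  -- step
  have hη : ∃ η : ℝ, 0 < η ∧ η ≤ m ∧ η ≤ C - c β ∧ η * δ ≤ 1 / 2 := by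
    refine ⟨min (min m (C - c β)) (1 / 2 / (δ + 1)), ?_, ?_, ?_, ?_⟩
    · have : 0 < C - c β := by linarith
      positivity
    · exact (min_le_left _ _).trans (min_le_left _ _)
    · exact (min_le_left _ _).trans (min_le_right _ _)
    · calc _ ≤ (1 / 2 / (δ + 1)) * δ := by gcongr; exact min_le_right _ _
        _ ≤ 1 / 2 := by
          rw [div_mul_eq_mul_div, div_le_iff₀ (by linarith)]; linarith
  obtain ⟨η, hη0, hηm, hηC, hηδ⟩ := hη
  set c' : κ → ℝ := fun γ => if γ = β then c γ + η else
    (if 1 / 2 ≤ c γ then c γ - η * δ else c γ) with hc'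
  have hηδ0 : 0 ≤ η * δ := mul_nonneg hη0.le hδ
  have hc'β : c' β = c β + η := by simp [hc']
  have hc'0 : ∀ γ, 0 ≤ c' γ := by
    intro γ
    simp only [hc']
    split_ifs with h h'
    · linarith [h0 γ]
    · linarith
    · exact h0 γ
  have hc'C : ∀ γ, c' γ ≤ C := by
    intro γ
    simp only [hc']
    split_ifs with h h'
    · rw [h]; linarith
    · linarith [h1 γ]
    · exact h1 γ
  have hc'le : ∀ γ, γ ≠ β → c' γ ≤ c γ := by
    intro γ h
    simp only [hc', if_neg h]
    split_ifs <;> linarith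
  have hc'ge : ∀ γ, γ ≠ β → c γ - η * δ ≤ c' γ := by
    intro γ h
    simp only [hc', if_neg h]
    split_ifs <;> linarith
  have hsplit : ∀ (f : κ → ℝ) (b : κ), ∑ γ, f γ = f b + ∑ γ ∈ Finset.univ.erase b, f γ := by
    intro f b
    rw [Finset.add_sum_erase _ _ (Finset.mem_univ b)]
  have hcard : ∀ b : κ, ((Finset.univ.erase b).card : ℝ) ≤ Fintype.card κ := by
    intro b
    exact_mod_cast (Finset.card_le_card (Finset.erase_subset _ _))
  have hc'S : c' ∈ S := by
    refine ⟨⟨hc'0, hc'C⟩, ?_⟩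
    intro x
    by_cases hex : ∃ γ, A x ≤ K * M γ x ∧ 0 < M γ x
    · obtain ⟨γ, hγ1, hγ2⟩ := hex
      by_cases hγβ : γ = β
      · subst hγβ
        have h5 : ∑ ρ, c' ρ * M ρ x ≤ η * M γ x + ∑ ρ, c ρ * M ρ x := by
          rw [hsplit _ γ, hsplit (fun ρ => c ρ * M ρ x) γ, hc'β]
          have : ∑ ρ ∈ Finset.univ.erase γ, c' ρ * M ρ x
              ≤ ∑ ρ ∈ Finset.univ.erase γ, c ρ * M ρ x := by
            apply Finset.sum_le_sum
            intro ρ hρ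
            exact mul_le_mul_of_nonneg_right (hc'le ρ (Finset.ne_of_mem_erase hρ)) (hM ρ x)
          linarith
        have h6 := hmm x hγ1 hγ2
        have h7 : η * M γ x ≤ m * M γ x := mul_le_mul_of_nonneg_right hηm hγ2.le
        linarith
      · by_cases hG : 1 / 2 ≤ c γ
        · have hcg : c' γ = c γ - η * δ := by simp only [hc', if_neg hγβ, if_pos hG]
          have hβγ : M β x ≤ δ * M γ x := ha γ x hγ1 hγ2 β (Ne.symm hγβ)
          have h5 : ∑ ρ, c' ρ * M ρ x ≤ ∑ ρ, c ρ * M ρ x + η * M β x - η * δ * M γ x := by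
            have : ∑ ρ, (c' ρ - c ρ) * M ρ x ≤ ∑ ρ, ((if ρ = β then η * M β x else 0) +
                (if ρ = γ then - (η * δ * M γ x) else 0)) := by
              apply Finset.sum_le_sum
              intro ρ _
              by_cases hρ1 : ρ = β
              · subst hρ1
                rw [if_pos rfl, if_neg (Ne.symm hγβ), hc'β]
                apply le_of_eq; ring
              · by_cases hρ2 : ρ = γ
                · subst hρ2
                  rw [if_neg hρ1, if_pos rfl, hcg]
                  apply le_of_eq; ring
                · rw [if_neg hρ1, if_neg hρ2]
                  have := hc'le ρ hρ1
                  have := hM ρ x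
                  nlinarith
            rw [Finset.sum_add_distrib] at this
            simp only [Finset.sum_ite_eq', Finset.mem_univ, if_true] at this
            have h8 : ∑ ρ, (c' ρ - c ρ) * M ρ x = ∑ ρ, c' ρ * M ρ x - ∑ ρ, c ρ * M ρ x := by
              rw [← Finset.sum_sub_distrib]
              apply Finset.sum_congr rfl
              intros; ring
            linarith
          have h6 := h2 x
          have h7 : η * M β x ≤ η * (δ * M γ x) := mul_le_mul_of_nonneg_left hβγ hη0.le
          linarith
        · have hcg : c' γ = c γ := by simp only [hc', if_neg hγβ, if_neg hG]
          have h5 : ∑ ρ, c' ρ * M ρ x ≤ 1 / 2 * M γ x + 1 / 2 * M γ x := by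
            rw [hsplit _ γ, hcg]
            have h6 : ∑ ρ ∈ Finset.univ.erase γ, c' ρ * M ρ x
                ≤ ∑ ρ ∈ Finset.univ.erase γ, C * (δ * M γ x) := by
              apply Finset.sum_le_sum
              intro ρ hρ
              exact mul_le_mul (hc'C ρ) (ha γ x hγ1 hγ2 ρ (Finset.ne_of_mem_erase hρ))
                (hM ρ x) hC.le
            rw [Finset.sum_const, nsmul_eq_mul] at h6
            have h7 : ((Finset.univ.erase γ).card : ℝ) * (C * (δ * M γ x)) ≤
                (Fintype.card κ) * (C * (δ * M γ x)) :=
              mul_le_mul_of_nonneg_right (hcard γ) (by positivity)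
            have h8 : (Fintype.card κ) * (C * (δ * M γ x)) ≤ 1 / 2 * M γ x := by
              have := mul_le_mul_of_nonneg_right hδ2 hγ2.le
              linarith
            have h9 : c γ * M γ x ≤ 1 / 2 * M γ x := by
              apply mul_le_mul_of_nonneg_right _ hγ2.le
              linarith
            linarith
          have := hb γ x hγ1 hγ2
          linarith
    · push Not at hex
      have h5 : ∀ γ, c' γ * M γ x ≤ C * (A x / K) := by
        intro γ
        apply mul_le_mul (hc'C γ) _ (hM γ x) hC.le
        rw [le_div_iff₀ hK0]
        by_contra hcon
        push Not at hcon
        have h6 := hex γ (by linarith)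
        have h7 : M γ x = 0 := le_antisymm h6 (hM γ x)
        rw [h7] at hcon
        linarith [hA x]
      have h6 : ∑ γ, c' γ * M γ x ≤ ∑ γ : κ, C * (A x / K) := Finset.sum_le_sum (fun γ _ => h5 γ)
      rw [Finset.sum_const, nsmul_eq_mul, Finset.card_univ] at h6
      have h7 : (Fintype.card κ : ℝ) * (C * (A x / K)) ≤ A x := by
        have : (Fintype.card κ : ℝ) * (C * (A x / K)) = (C * Fintype.card κ) * A x / K := by ring
        rw [this, div_le_iff₀ hK0]
        nlinarith [hA x, mul_le_mul_of_nonneg_right hK (hA x)]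
      linarith
  have h10 := hmax hc'S
  simp only [Set.mem_ofPred_eq] at h10
  rw [hsplit c' β, hsplit c β, hc'β] at h10
  have h11 : ∑ γ ∈ Finset.univ.erase β, (c γ - η * δ) ≤ ∑ γ ∈ Finset.univ.erase β, c' γ :=
    Finset.sum_le_sum (fun γ hγ => hc'ge γ (Finset.ne_of_mem_erase hγ))
  rw [Finset.sum_sub_distrib, Finset.sum_const, nsmul_eq_mul] at h11
  have h12 : ((Finset.univ.erase β).card : ℝ) * (η * δ) ≤ Fintype.card κ * (η * δ) :=
    mul_le_mul_of_nonneg_right (hcard β) hηδ0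
  have h13 : Fintype.card κ * (η * δ) < η := by nlinarith
  linarith

end FC

namespace FC
open scoped NNReal

/-- The quadratic form used for the patchworking function. -/
def q (a c : ℤ) : ℤ := a ^ 2 - a * c + c ^ 2

theorem q_pos {a c : ℤ} (h : a ≠ 0 ∨ c ≠ 0) : 1 ≤ q a c := by
  have h1 : 0 < 4 * q a c := by
    have : 4 * q a c = (2 * a - c) ^ 2 + 3 * c ^ 2 := by unfold q; ring
    rw [this]
    by_cases hc : c = 0
    · subst hc
      have ha : a ≠ 0 := by tauto
      have : 0 < a ^ 2 := by positivity
      nlinarith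
    · positivity
  omega

theorem q_nonneg (a c : ℤ) : 0 ≤ q a c := by
  by_cases h : a ≠ 0 ∨ c ≠ 0
  · linarith [q_pos h]
  · push Not at h
    simp [q, h.1, h.2]

/-- Weighted monomials. -/
noncomputable def h (s : ℝ) (w : ℕ × ℕ) (U : ℝ≥0 × ℝ≥0) : ℝ :=
  s ^ (q w.1 w.2) * (U.1 : ℝ) ^ w.1 * (U.2 : ℝ) ^ w.2

theorem h_nonneg {s : ℝ} (hs : 0 < s) (w U) : 0 ≤ h s w U := by
  unfold h; positivity

/-- A frame at a point `β`. -/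
structure Frame (V : Finset (ℕ × ℕ)) (k N : ℕ) (β v1 v2 v3 : ℕ × ℕ) : Prop where
  m1 : v1 ∈ V
  m2 : v2 ∈ V
  m3 : v3 ∈ V
  q1 : q (v1.1 - β.1) (v1.2 - β.2) = 1
  q2 : q (v2.1 - β.1) (v2.2 - β.2) = 1
  q3 : q (v3.1 - β.1) (v3.2 - β.2) = 1
  rep : ∀ γ : ℕ × ℕ, γ.1 ≤ k + 1 → γ.2 ≤ k + 1 → ∃ n1 n2 n3 : ℕ, n1 + n2 + n3 ≤ N ∧
    γ.1 + (n1 + n2 + n3) * β.1 = β.1 + n1 * v1.1 + n2 * v2.1 + n3 * v3.1 ∧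
    γ.2 + (n1 + n2 + n3) * β.2 = β.2 + n1 * v1.2 + n2 * v2.2 + n3 * v3.2 ∧
    (β.1 = 0 → n3 = γ.1) ∧ (β.2 = 0 → n3 = γ.2)
  cyc : (v1.1 + v2.1 + v3.1 = 3 * β.1 ∧ v1.2 + v2.2 + v3.2 = 3 * β.2) ∨
    (v1.1 + v2.1 = 2 * β.1 ∧ v1.2 + v2.2 = 2 * β.2)
  e1 : β.1 = 0 → v3.1 = 1
  e2 : β.2 = 0 → v3.2 = 1
  nz : β.1 ≠ 0 ∨ β.2 ≠ 0

/-- normalized monomial -/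
noncomputable def pp (s : ℝ) (β v : ℕ × ℕ) (U : ℝ≥0 × ℝ≥0) : ℝ := h s v U / (s * h s β U)

theorem pp_nonneg {s : ℝ} (hs : 0 < s) (β w U) : 0 ≤ pp s β w U :=
  div_nonneg (h_nonneg hs _ _) (mul_nonneg hs.le (h_nonneg hs _ _))

theorem h_pp {s : ℝ} (hs : 0 < s) {β : ℕ × ℕ} {U} (hβ : 0 < h s β U) (v) :
    h s v U = s * h s β U * pp s β v U := by
  unfold pp
  field_simp

theorem local_mul {s : ℝ} (hs : 0 < s) {β v1 v2 v3 γ : ℕ × ℕ} (U : ℝ≥0 × ℝ≥0)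
    (q1 : q (v1.1 - β.1) (v1.2 - β.2) = 1)
    (q2 : q (v2.1 - β.1) (v2.2 - β.2) = 1)
    (q3 : q (v3.1 - β.1) (v3.2 - β.2) = 1) {n1 n2 n3 : ℕ}
    (e1 : γ.1 + (n1 + n2 + n3) * β.1 = β.1 + n1 * v1.1 + n2 * v2.1 + n3 * v3.1)
    (e2 : γ.2 + (n1 + n2 + n3) * β.2 = β.2 + n1 * v1.2 + n2 * v2.2 + n3 * v3.2) :
    h s γ U * (s * h s β U) ^ (n1 + n2 + n3) =
      s ^ q (γ.1 - β.1) (γ.2 - β.2) * h s β U *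
        (h s v1 U ^ n1 * h s v2 U ^ n2 * h s v3 U ^ n3) := by
  have e3 : q γ.1 γ.2 + (n1 + n2 + n3) * (1 + q β.1 β.2) =
      q (γ.1 - β.1) (γ.2 - β.2) + q β.1 β.2 + n1 * q v1.1 v1.2 + n2 * q v2.1 v2.2
        + n3 * q v3.1 v3.2 := by
    have f1 : (γ.1 : ℤ) = β.1 + n1 * (v1.1 - β.1) + n2 * (v2.1 - β.1) + n3 * (v3.1 - β.1) := by
      have : ((γ.1 + (n1 + n2 + n3) * β.1 : ℕ) : ℤ) =
        (β.1 + n1 * v1.1 + n2 * v2.1 + n3 * v3.1 : ℕ) := by rw [e1]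
      push_cast at this
      linarith
    have f2 : (γ.2 : ℤ) = β.2 + n1 * (v1.2 - β.2) + n2 * (v2.2 - β.2) + n3 * (v3.2 - β.2) := by
      have : ((γ.2 + (n1 + n2 + n3) * β.2 : ℕ) : ℤ) =
        (β.2 + n1 * v1.2 + n2 * v2.2 + n3 * v3.2 : ℕ) := by rw [e2]
      push_cast at this
      linarith
    rw [f1, f2]
    unfold q at *
    linear_combination (-(n1 : ℤ)) * q1 - (n2 : ℤ) * q2 - (n3 : ℤ) * q3
  have e4 : s ^ q γ.1 γ.2 * (s * s ^ q β.1 β.2) ^ (n1 + n2 + n3) =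
      s ^ q (γ.1 - β.1) (γ.2 - β.2) * s ^ q β.1 β.2 *
        ((s ^ q v1.1 v1.2) ^ n1 * (s ^ q v2.1 v2.2) ^ n2 * (s ^ q v3.1 v3.2) ^ n3) := by
    have h0 : s ≠ 0 := hs.ne'
    simp only [← zpow_natCast, ← zpow_mul, ← zpow_one_add₀ h0]
    simp only [← zpow_add₀ h0]
    congr 1
    push_cast
    linarith
  have e5 : (U.1 : ℝ) ^ γ.1 * ((U.1 : ℝ) ^ β.1) ^ (n1 + n2 + n3) = (U.1 : ℝ) ^ β.1 *
      (((U.1 : ℝ) ^ v1.1) ^ n1 * ((U.1 : ℝ) ^ v2.1) ^ n2 * ((U.1 : ℝ) ^ v3.1) ^ n3) := by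
    simp only [← pow_mul, ← pow_add]
    congr 1
    linarith
  have e6 : (U.2 : ℝ) ^ γ.2 * ((U.2 : ℝ) ^ β.2) ^ (n1 + n2 + n3) = (U.2 : ℝ) ^ β.2 *
      (((U.2 : ℝ) ^ v1.2) ^ n1 * ((U.2 : ℝ) ^ v2.2) ^ n2 * ((U.2 : ℝ) ^ v3.2) ^ n3) := by
    simp only [← pow_mul, ← pow_add]
    congr 1
    linarith
  unfold h
  have := congrArg₂ (· * ·) (congrArg₂ (· * ·) e4 e5) e6
  calc _ = _ := by
        simp only [mul_pow]; ring
    _ = _ := this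
    _ = _ := by simp only [mul_pow]; ring

theorem local_eq {s : ℝ} (hs : 0 < s) {β v1 v2 v3 γ : ℕ × ℕ} {U : ℝ≥0 × ℝ≥0}
    (q1 : q (v1.1 - β.1) (v1.2 - β.2) = 1)
    (q2 : q (v2.1 - β.1) (v2.2 - β.2) = 1)
    (q3 : q (v3.1 - β.1) (v3.2 - β.2) = 1) {n1 n2 n3 : ℕ}
    (e1 : γ.1 + (n1 + n2 + n3) * β.1 = β.1 + n1 * v1.1 + n2 * v2.1 + n3 * v3.1)
    (e2 : γ.2 + (n1 + n2 + n3) * β.2 = β.2 + n1 * v1.2 + n2 * v2.2 + n3 * v3.2)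
    (hβ : 0 < h s β U) :
    h s γ U = s ^ q (γ.1 - β.1) (γ.2 - β.2) * h s β U *
        (pp s β v1 U ^ n1 * pp s β v2 U ^ n2 * pp s β v3 U ^ n3) := by
  have := local_mul hs U q1 q2 q3 e1 e2
  have hne : (s * h s β U) ^ (n1 + n2 + n3) ≠ 0 := by positivity
  rw [← mul_left_inj' hne, this]
  unfold pp
  simp only [div_pow]
  rw [pow_add, pow_add]
  field_simp

theorem zpow_le_of_one_le {s : ℝ} (hs : 0 < s) (hs1 : s ≤ 1) {n : ℤ} (hn : 1 ≤ n) :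
    s ^ n ≤ s := by
  calc s ^ n ≤ s ^ (1 : ℤ) := zpow_le_zpow_right_of_le_one₀ hs hs1 hn
    _ = s := zpow_one s

/-- product bound -/
theorem prod_le {K a b c : ℝ} (hK : 1 ≤ K) (ha : 0 ≤ a) (hb : 0 ≤ b) (hc : 0 ≤ c)
    (ha' : a ≤ K) (hb' : b ≤ K) (hc' : c ≤ K) {n1 n2 n3 N : ℕ} (hN : n1 + n2 + n3 ≤ N) :
    a ^ n1 * b ^ n2 * c ^ n3 ≤ K ^ N := by
  calc a ^ n1 * b ^ n2 * c ^ n3 ≤ K ^ n1 * K ^ n2 * K ^ n3 := by gcongr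
    _ = K ^ (n1 + n2 + n3) := by ring
    _ ≤ K ^ N := pow_le_pow_right₀ hK hN

theorem pow_lip {K a b : ℝ} (hK : 1 ≤ K) (ha : 0 ≤ a) (hb : 0 ≤ b)
    (ha' : a ≤ K) (hb' : b ≤ K) (n : ℕ) : |a ^ n - b ^ n| ≤ n * K ^ n * |a - b| := by
  induction n with
  | zero => simp
  | succ n ih =>
    have e : a ^ (n + 1) - b ^ (n + 1) = a * (a ^ n - b ^ n) + b ^ n * (a - b) := by ring
    rw [e]
    calc _ ≤ |a * (a ^ n - b ^ n)| + |b ^ n * (a - b)| := abs_add_le _ _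
      _ = a * |a ^ n - b ^ n| + b ^ n * |a - b| := by
          rw [abs_mul, abs_mul, abs_of_nonneg ha, abs_of_nonneg (pow_nonneg hb n)]
      _ ≤ K * (n * K ^ n * |a - b|) + K ^ (n + 1) * |a - b| := by
          have : b ^ n ≤ K ^ (n + 1) :=
            (pow_le_pow_left₀ hb hb' n).trans (pow_le_pow_right₀ hK (Nat.le_succ n))
          gcongr
      _ = _ := by push_cast; ring

theorem prod_lip {K a b c a' b' c' : ℝ} (hK : 1 ≤ K) (ha : 0 ≤ a) (hb : 0 ≤ b) (hc : 0 ≤ c)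
    (ha1 : a ≤ K) (hb1 : b ≤ K) (hc1 : c ≤ K) (ha' : 0 ≤ a') (hb' : 0 ≤ b') (hc' : 0 ≤ c')
    (ha2 : a' ≤ K) (hb2 : b' ≤ K) (hc2 : c' ≤ K) {n1 n2 n3 N : ℕ} (hN : n1 + n2 + n3 ≤ N) {D : ℝ}
    (hDa : |a - a'| ≤ D) (hDb : |b - b'| ≤ D) (hDc : |c - c'| ≤ D) :
    |a ^ n1 * b ^ n2 * c ^ n3 - a' ^ n1 * b' ^ n2 * c' ^ n3| ≤ N * K ^ N * D := by
  have hD : 0 ≤ D := (abs_nonneg _).trans hDa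
  have e : a ^ n1 * b ^ n2 * c ^ n3 - a' ^ n1 * b' ^ n2 * c' ^ n3 =
    (a ^ n1 - a' ^ n1) * (b ^ n2 * c ^ n3) + (a' ^ n1 * (b ^ n2 - b' ^ n2)) * c ^ n3
      + (a' ^ n1 * b' ^ n2) * (c ^ n3 - c' ^ n3) := by ring
  rw [e]
  refine (abs_add_three _ _ _).trans ?_
  simp only [abs_mul]
  rw [abs_of_nonneg (pow_nonneg hb n2), abs_of_nonneg (pow_nonneg hc n3),
    abs_of_nonneg (pow_nonneg ha' n1), abs_of_nonneg (pow_nonneg hb' n2)]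
  have l1 := pow_lip hK ha ha' ha1 ha2 n1
  have l2 := pow_lip hK hb hb' hb1 hb2 n2
  have l3 := pow_lip hK hc hc' hc1 hc2 n3
  calc _ ≤ (n1 * K ^ n1 * D) * (K ^ n2 * K ^ n3) + (K ^ n1 * (n2 * K ^ n2 * D)) * K ^ n3
      + (K ^ n1 * K ^ n2) * (n3 * K ^ n3 * D) := by
        gcongr
        · exact l1.trans (by gcongr)
        · exact l2.trans (by gcongr)
        · exact l3.trans (by gcongr)
    _ = ((n1 + n2 + n3 : ℕ) : ℝ) * K ^ (n1 + n2 + n3) * D := by push_cast; ring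
    _ ≤ N * K ^ N * D := by
        gcongr

end FC

namespace FC
open scoped NNReal

noncomputable def AA (s : ℝ) (V : Finset (ℕ × ℕ)) (U : ℝ≥0 × ℝ≥0) : ℝ := ∑ v ∈ V, h s v U ^ 2

noncomputable def MM (s : ℝ) (β : ℕ × ℕ) (U : ℝ≥0 × ℝ≥0) : ℝ := s ^ 2 * h s β U ^ 2

theorem AA_nonneg (s V U) : 0 ≤ AA s V U := Finset.sum_nonneg (fun _ _ => sq_nonneg _)

theorem MM_nonneg (s β U) : 0 ≤ MM s β U := by unfold MM; positivity

theorem sq_le_AA {s V v} (hv : v ∈ V) (U) : h s v U ^ 2 ≤ AA s V U :=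
  Finset.single_le_sum (f := fun v => h s v U ^ 2) (fun _ _ => sq_nonneg _) hv

theorem h_cont (s w) : Continuous (h s w) := by
  unfold h
  fun_prop

theorem AA_cont (s V) : Continuous (AA s V) := by
  unfold AA
  exact continuous_finsetSum _ (fun v _ => (h_cont s v).pow 2)

theorem MM_cont (s β) : Continuous (MM s β) := by
  unfold MM
  exact continuous_const.mul ((h_cont s β).pow 2)

theorem hpos_of_MM {s : ℝ} (hs : 0 < s) {β U} (hM : 0 < MM s β U) : 0 < h s β U := by
  rcases (h_nonneg hs β U).lt_or_eq with h1 | h1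
  · exact h1
  · simp [MM, ← h1] at hM

theorem pp_sq {s : ℝ} (hs : 0 < s) {β U} (hβ : 0 < h s β U) (v) :
    h s v U ^ 2 = pp s β v U ^ 2 * MM s β U := by
  rw [h_pp hs hβ v]
  unfold MM; ring

theorem pp_le {s K : ℝ} (hs : 0 < s) (hK : 1 ≤ K) {V : Finset (ℕ × ℕ)} {β U}
    (hA : AA s V U ≤ K * MM s β U) (hM : 0 < MM s β U) {v} (hv : v ∈ V) : pp s β v U ≤ K := by
  have hβ := hpos_of_MM hs hM
  have h1 := (sq_le_AA hv U).trans hA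
  rw [pp_sq hs hβ v] at h1
  have h2 : pp s β v U ^ 2 ≤ K := le_of_mul_le_mul_right h1 hM
  by_contra hcon
  push Not at hcon
  nlinarith

section zone
variable {s K : ℝ} {V : Finset (ℕ × ℕ)} {k N : ℕ} {β v1 v2 v3 : ℕ × ℕ}

theorem zone_le (hs : 0 < s) (hK : 1 ≤ K) (fr : Frame V k N β v1 v2 v3) {U}
    (hA : AA s V U ≤ K * MM s β U) (hM : 0 < MM s β U) {γ : ℕ × ℕ} (hγ1 : γ.1 ≤ k + 1)
    (hγ2 : γ.2 ≤ k + 1) :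
    h s γ U ≤ s ^ q (γ.1 - β.1) (γ.2 - β.2) * h s β U * K ^ N := by
  have hβ := hpos_of_MM hs hM
  obtain ⟨n1, n2, n3, hn, e1, e2, -, -⟩ := fr.rep γ hγ1 hγ2
  rw [local_eq hs fr.q1 fr.q2 fr.q3 e1 e2 hβ]
  apply mul_le_mul_of_nonneg_left _ (by positivity)
  exact prod_le hK (pp_nonneg hs _ _ _) (pp_nonneg hs _ _ _) (pp_nonneg hs _ _ _)
    (pp_le hs hK hA hM fr.m1) (pp_le hs hK hA hM fr.m2) (pp_le hs hK hA hM fr.m3) hn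

theorem q_ne {γ β : ℕ × ℕ} (hne : γ ≠ β) : 1 ≤ q (γ.1 - β.1) (γ.2 - β.2) := by
  apply q_pos
  by_contra hcon
  push Not at hcon
  apply hne
  ext <;> omega

theorem zone_a (hs : 0 < s) (hs1 : s ≤ 1) (hK : 1 ≤ K) (fr : Frame V k N β v1 v2 v3) {U}
    (hA : AA s V U ≤ K * MM s β U) (hM : 0 < MM s β U) {γ : ℕ × ℕ} (hγ1 : γ.1 ≤ k + 1)
    (hγ2 : γ.2 ≤ k + 1) (hne : γ ≠ β) :
    MM s γ U ≤ s ^ 2 * K ^ (2 * N) * MM s β U := by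
  have hβ := hpos_of_MM hs hM
  have h1 := zone_le hs hK fr hA hM hγ1 hγ2
  have h2 : h s γ U ≤ s * h s β U * K ^ N := h1.trans (by
    gcongr
    exact zpow_le_of_one_le hs hs1 (q_ne hne))
  have h3 : h s γ U ^ 2 ≤ (s * h s β U * K ^ N) ^ 2 := pow_le_pow_left₀ (h_nonneg hs _ _) h2 2
  unfold MM
  calc s ^ 2 * h s γ U ^ 2 ≤ s ^ 2 * (s * h s β U * K ^ N) ^ 2 := by gcongr
    _ = _ := by ring

theorem zone_b (hs : 0 < s) (fr : Frame V k N β v1 v2 v3) {U}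
    (hM : 0 < MM s β U) : MM s β U ≤ AA s V U := by
  have hβ := hpos_of_MM hs hM
  have key : ∀ v ∈ V, 1 ≤ pp s β v U → MM s β U ≤ AA s V U := by
    intro v hv h1
    refine le_trans ?_ (sq_le_AA hv U)
    rw [pp_sq hs hβ v]
    have : 1 ≤ pp s β v U ^ 2 := one_le_pow₀ h1
    nlinarith
  have p1 := pp_nonneg hs β v1 U
  have p2 := pp_nonneg hs β v2 U
  have p3 := pp_nonneg hs β v3 U
  have hz : q ((β.1 : ℤ) - β.1) (β.2 - β.2) = 0 := by simp [q]
  by_contra hcon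
  have l1 : pp s β v1 U < 1 := by by_contra h; exact hcon (key v1 fr.m1 (not_lt.1 h))
  have l2 : pp s β v2 U < 1 := by by_contra h; exact hcon (key v2 fr.m2 (not_lt.1 h))
  have l3 : pp s β v3 U < 1 := by by_contra h; exact hcon (key v3 fr.m3 (not_lt.1 h))
  rcases fr.cyc with ⟨c1, c2⟩ | ⟨c1, c2⟩
  · have := local_eq (γ := β) (n1 := 1) (n2 := 1) (n3 := 1) hs fr.q1 fr.q2 fr.q3
      (by linarith) (by linarith) hβ
    rw [hz] at this
    simp only [zpow_zero, one_mul, pow_one] at this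
    have e : pp s β v1 U * pp s β v2 U * pp s β v3 U = 1 := by
      apply mul_left_cancel₀ hβ.ne'
      rw [← this, mul_one]
    have : pp s β v1 U * pp s β v2 U * pp s β v3 U < 1 := by
      have : pp s β v1 U * pp s β v2 U ≤ 1 := by nlinarith
      have h0 : 0 ≤ pp s β v1 U * pp s β v2 U := by positivity
      nlinarith
    linarith
  · have := local_eq (γ := β) (n1 := 1) (n2 := 1) (n3 := 0) hs fr.q1 fr.q2 fr.q3
      (by linarith) (by linarith) hβ
    rw [hz] at this
    simp only [zpow_zero, one_mul, pow_one, pow_zero, mul_one] at this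
    have e : pp s β v1 U * pp s β v2 U = 1 := by
      apply mul_left_cancel₀ hβ.ne'
      rw [← this, mul_one]
    nlinarith

theorem center (hs : 0 < s) (β : ℕ × ℕ) : ∃ U : ℝ≥0 × ℝ≥0, 0 < h s β U ∧
    ∀ γ : ℕ × ℕ, h s γ U = s ^ q (γ.1 - β.1) (γ.2 - β.2) * h s β U := by
  let S : ℝ≥0 := ⟨s, hs.le⟩
  have hS : (S : ℝ) = s := rfl
  refine ⟨(S ^ (-(2 * β.1 - β.2 : ℤ)), S ^ (-(2 * β.2 - β.1 : ℤ))), ?_, ?_⟩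
  · unfold h
    push_cast
    rw [hS]
    positivity
  · intro γ
    unfold h
    push_cast
    rw [hS]
    have h0 : s ≠ 0 := hs.ne'
    simp only [← zpow_natCast, ← zpow_mul]
    simp only [← zpow_add₀ h0]
    congr 1
    unfold q
    ring

theorem zone_c (hs : 0 < s) (hs1 : s ≤ 1) (β : ℕ × ℕ) (hβV : β ∉ V) :
    ∃ U, 0 < MM s β U ∧ AA s V U ≤ V.card * MM s β U := by
  obtain ⟨U, h1, h2⟩ := center hs β
  refine ⟨U, by unfold MM; positivity, ?_⟩
  unfold AA
  rw [← nsmul_eq_mul, ← Finset.sum_const]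
  apply Finset.sum_le_sum
  intro v hv
  rw [h2]
  have h3 := zpow_le_of_one_le hs hs1 (q_ne (γ := v) (β := β) (fun e => hβV (e ▸ hv)))
  have h4 : 0 ≤ s ^ q (v.1 - β.1) (v.2 - β.2) := by positivity
  unfold MM
  rw [mul_pow]
  gcongr

theorem coord1 (hs : 0 < s) (fr : Frame V k N β v1 v2 v3) (hk1 : β.1 ≤ k) (hk2 : β.2 ≤ k) :
    ∃ (n1 n2 n3 : ℕ) (c : ℝ), 0 ≤ c ∧ n1 + n2 + n3 ≤ N ∧ ∀ U : ℝ≥0 × ℝ≥0, 0 < h s β U →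
      (U.1 : ℝ) = c * (pp s β v1 U ^ n1 * pp s β v2 U ^ n2 * pp s β v3 U ^ n3) := by
  obtain ⟨n1, n2, n3, hn, e1, e2, -, -⟩ := fr.rep (β.1 + 1, β.2) (by simp; omega) (by simp; omega)
  refine ⟨n1, n2, n3, s ^ q ((β.1 + 1 : ℕ) - β.1) (β.2 - β.2) * s ^ (q β.1 β.2 - q (β.1 + 1 : ℕ) β.2),
    by positivity, hn, ?_⟩
  intro U hβ
  have := local_eq hs fr.q1 fr.q2 fr.q3 e1 e2 hβ
  have e3 : h s (β.1 + 1, β.2) U = s ^ (q (β.1 + 1 : ℕ) β.2 - q β.1 β.2) * h s β U * U.1 := by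
    unfold h
    rw [zpow_sub₀ hs.ne']
    field_simp
    ring
  rw [e3] at this
  have h0 : s ≠ 0 := hs.ne'
  rw [zpow_sub₀ hs.ne'] at this ⊢
  field_simp at this ⊢
  linarith

theorem coord2 (hs : 0 < s) (fr : Frame V k N β v1 v2 v3) (hk1 : β.1 ≤ k) (hk2 : β.2 ≤ k) :
    ∃ (n1 n2 n3 : ℕ) (c : ℝ), 0 ≤ c ∧ n1 + n2 + n3 ≤ N ∧ ∀ U : ℝ≥0 × ℝ≥0, 0 < h s β U →
      (U.2 : ℝ) = c * (pp s β v1 U ^ n1 * pp s β v2 U ^ n2 * pp s β v3 U ^ n3) := by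
  obtain ⟨n1, n2, n3, hn, e1, e2, -, -⟩ := fr.rep (β.1, β.2 + 1) (by simp; omega) (by simp; omega)
  refine ⟨n1, n2, n3, s ^ q (β.1 - β.1) ((β.2 + 1 : ℕ) - β.2) * s ^ (q β.1 β.2 - q β.1 (β.2 + 1 : ℕ)),
    by positivity, hn, ?_⟩
  intro U hβ
  have := local_eq hs fr.q1 fr.q2 fr.q3 e1 e2 hβ
  have e3 : h s (β.1, β.2 + 1) U = s ^ (q β.1 (β.2 + 1 : ℕ) - q β.1 β.2) * h s β U * U.2 := by
    unfold h
    rw [zpow_sub₀ hs.ne']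
    field_simp
    ring
  rw [e3] at this
  have h0 : s ≠ 0 := hs.ne'
  rw [zpow_sub₀ hs.ne'] at this ⊢
  field_simp at this ⊢
  linarith

theorem zone_d (hs : 0 < s) (hs1 : s ≤ 1) (hK : 1 ≤ K) (fr : Frame V k N β v1 v2 v3)
    (hk1 : β.1 ≤ k) (hk2 : β.2 ≤ k) (F : ℝ≥0 × ℝ≥0 → ℝ) (hF : Continuous F)
    (hpos : ∀ U, AA s V U ≤ K * MM s β U → 0 < MM s β U → 0 < F U) :
    ∃ m, 0 < m ∧ ∀ U, AA s V U ≤ K * MM s β U → 0 < MM s β U → m * MM s β U ≤ F U := by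
  obtain ⟨n1, n2, n3, c, hc, hn, hU1⟩ := coord1 hs fr hk1 hk2
  obtain ⟨n1', n2', n3', c', hc', hn', hU2⟩ := coord2 hs fr hk1 hk2
  set r : ℝ := 1 / K ^ N with hr
  have hr0 : 0 < r := by positivity
  set R : ℝ≥0 × ℝ≥0 := (Real.toNNReal (c * K ^ N), Real.toNNReal (c' * K ^ N)) with hR
  set Z : Set (ℝ≥0 × ℝ≥0) := Set.Icc 0 R ∩ ({U | AA s V U ≤ K * MM s β U} ∩ {U | r ≤ h s β U})
    with hZ
  have hZc : IsCompact Z := by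
    apply IsCompact.inter_right isCompact_Icc
    apply IsClosed.inter
    · exact isClosed_le (AA_cont _ _) (continuous_const.mul (MM_cont _ _))
    · exact isClosed_le continuous_const (h_cont _ _)
  have hsub : ∀ U, AA s V U ≤ K * MM s β U → 0 < MM s β U → U ∈ Z := by
    intro U hA hM
    have hβ := hpos_of_MM hs hM
    have pb : ∀ {m1 m2 m3 : ℕ}, m1 + m2 + m3 ≤ N →
        pp s β v1 U ^ m1 * pp s β v2 U ^ m2 * pp s β v3 U ^ m3 ≤ K ^ N := fun hm =>
      prod_le hK (pp_nonneg hs _ _ _) (pp_nonneg hs _ _ _) (pp_nonneg hs _ _ _)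
        (pp_le hs hK hA hM fr.m1) (pp_le hs hK hA hM fr.m2) (pp_le hs hK hA hM fr.m3) hm
    refine ⟨⟨zero_le, ?_, ?_⟩, hA, ?_⟩
    · apply NNReal.le_toNNReal_of_coe_le
      rw [hU1 U hβ]
      exact mul_le_mul_of_nonneg_left (pb hn) hc
    · apply NNReal.le_toNNReal_of_coe_le
      rw [hU2 U hβ]
      exact mul_le_mul_of_nonneg_left (pb hn') hc'
    · have := zone_le (γ := (0, 0)) hs hK fr hA hM (by simp) (by simp)
      have e : h s (0, 0) U = 1 := by simp [h, q]
      rw [e] at this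
      change r ≤ h s β U
      rw [hr, div_le_iff₀ (by positivity)]
      refine this.trans ?_
      apply mul_le_mul_of_nonneg_right _ (by positivity)
      have : s ^ q (((0, 0) : ℕ × ℕ).1 - β.1) (((0, 0) : ℕ × ℕ).2 - β.2) ≤ 1 :=
        by
        rw [← zpow_zero s]
        exact zpow_le_zpow_right_of_le_one₀ hs hs1 (q_nonneg _ _)
      nlinarith
  have hZM : ∀ U ∈ Z, 0 < MM s β U := by
    intro U hU
    have : 0 < h s β U := lt_of_lt_of_le hr0 hU.2.2
    unfold MM; positivity
  by_cases hne : Z.Nonempty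
  · obtain ⟨U0, hU0, hmin⟩ := hZc.exists_isMinOn hne (f := fun U => F U / MM s β U)
      (hF.continuousOn.div (MM_cont _ _).continuousOn (fun U hU => (hZM U hU).ne'))
    refine ⟨F U0 / MM s β U0, div_pos (hpos U0 hU0.2.1 (hZM U0 hU0)) (hZM U0 hU0), ?_⟩
    intro U hA hM
    have := hmin (hsub U hA hM)
    simp only [Set.mem_ofPred_eq] at this
    rwa [le_div_iff₀ hM] at this
  · refine ⟨1, one_pos, ?_⟩
    intro U hA hM
    exact absurd ⟨U, hsub U hA hM⟩ hne

end zone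
end FC

namespace FC
open scoped NNReal

noncomputable def GG (s : ℝ) (V B : Finset (ℕ × ℕ)) (c : ℕ × ℕ → ℝ) (U : ℝ≥0 × ℝ≥0) : ℝ :=
  AA s V U - ∑ γ ∈ B, c γ * MM s γ U

theorem h_mid {s : ℝ} (w : ℕ × ℕ) (U W : ℝ≥0 × ℝ≥0) :
    h s w (NNReal.sqrt (U.1 * W.1), NNReal.sqrt (U.2 * W.2)) ^ 2 = h s w U * h s w W := by
  have e : ∀ (x y : ℝ≥0) (n : ℕ), ((NNReal.sqrt (x * y) : ℝ) ^ n) ^ 2 = (x : ℝ) ^ n * (y : ℝ) ^ n := by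
    intro x y n
    rw [← pow_mul, mul_comm n 2, pow_mul, ← mul_pow]
    congr 1
    have := NNReal.sq_sqrt (x * y)
    exact_mod_cast this
  unfold h
  simp only [mul_pow, e]
  ring

section zone
variable {s K C : ℝ} {V B : Finset (ℕ × ℕ)} {k N : ℕ} {β v1 v2 v3 : ℕ × ℕ} {c : ℕ × ℕ → ℝ}

theorem zone_uniq (hs : 0 < s) (hs1 : s ≤ 1) (hK : 1 ≤ K) (fr : Frame V k N β v1 v2 v3)
    (hB : ∀ γ ∈ B, γ.1 ≤ k ∧ γ.2 ≤ k) (hβB : β ∈ B) (hcC : ∀ γ ∈ B, c γ ≤ C) (hC : 0 ≤ C)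
    (hsm : B.card * C * (s ^ 2 * (N * K ^ N) ^ 2) < 1)
    (hG : ∀ U, 0 ≤ GG s V B c U) {U W}
    (hAU : AA s V U ≤ K * MM s β U) (hMU : 0 < MM s β U) (hGU : GG s V B c U = 0)
    (hAW : AA s V W ≤ K * MM s β W) (hMW : 0 < MM s β W) (hGW : GG s V B c W = 0) : U = W := by
  have hβU := hpos_of_MM hs hMU
  have hβW := hpos_of_MM hs hMW
  set a : ℕ × ℕ → ℝ := fun v => h s v U / h s β U with ha
  set b : ℕ × ℕ → ℝ := fun v => h s v W / h s β W with hb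
  have ha' : ∀ v, h s v U = h s β U * a v := fun v => by simp only [ha]; field_simp
  have hb' : ∀ v, h s v W = h s β W * b v := fun v => by simp only [hb]; field_simp
  have E1 : ∑ v ∈ V, a v ^ 2 = s ^ 2 * ∑ γ ∈ B, c γ * a γ ^ 2 := by
    have e : GG s V B c U = h s β U ^ 2 * (∑ v ∈ V, a v ^ 2 - s ^ 2 * ∑ γ ∈ B, c γ * a γ ^ 2) := by
      unfold GG AA MM
      simp only [mul_sub, Finset.mul_sum]
      congr 1 <;> exact Finset.sum_congr rfl (fun v _ => by rw [ha' v]; ring)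
    rw [e] at hGU
    have : h s β U ^ 2 ≠ 0 := by positivity
    have := (mul_eq_zero.1 hGU).resolve_left this
    linarith
  have E2 : ∑ v ∈ V, b v ^ 2 = s ^ 2 * ∑ γ ∈ B, c γ * b γ ^ 2 := by
    have e : GG s V B c W = h s β W ^ 2 * (∑ v ∈ V, b v ^ 2 - s ^ 2 * ∑ γ ∈ B, c γ * b γ ^ 2) := by
      unfold GG AA MM
      simp only [mul_sub, Finset.mul_sum]
      congr 1 <;> exact Finset.sum_congr rfl (fun v _ => by rw [hb' v]; ring)
    rw [e] at hGW
    have : h s β W ^ 2 ≠ 0 := by positivity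
    have := (mul_eq_zero.1 hGW).resolve_left this
    linarith
  have E3 : s ^ 2 * ∑ γ ∈ B, c γ * (a γ * b γ) ≤ ∑ v ∈ V, a v * b v := by
    have e : GG s V B c (NNReal.sqrt (U.1 * W.1), NNReal.sqrt (U.2 * W.2)) =
        (h s β U * h s β W) * (∑ v ∈ V, a v * b v - s ^ 2 * ∑ γ ∈ B, c γ * (a γ * b γ)) := by
      unfold GG AA MM
      simp only [h_mid, mul_sub, Finset.mul_sum]
      congr 1 <;> exact Finset.sum_congr rfl (fun v _ => by rw [ha' v, hb' v]; ring)
    have h1 := hG (NNReal.sqrt (U.1 * W.1), NNReal.sqrt (U.2 * W.2))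
    rw [e] at h1
    have := nonneg_of_mul_nonneg_right h1 (by positivity)
    linarith
  have E4 : ∑ v ∈ V, (a v - b v) ^ 2 ≤ s ^ 2 * ∑ γ ∈ B, c γ * (a γ - b γ) ^ 2 := by
    have e1 : ∑ v ∈ V, (a v - b v) ^ 2 =
        ∑ v ∈ V, a v ^ 2 + ∑ v ∈ V, b v ^ 2 - 2 * ∑ v ∈ V, a v * b v := by
      rw [Finset.mul_sum, ← Finset.sum_add_distrib, ← Finset.sum_sub_distrib]
      exact Finset.sum_congr rfl (fun v _ => by ring)
    have e2 : ∑ γ ∈ B, c γ * (a γ - b γ) ^ 2 = ∑ γ ∈ B, c γ * a γ ^ 2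
        + ∑ γ ∈ B, c γ * b γ ^ 2 - 2 * ∑ γ ∈ B, c γ * (a γ * b γ) := by
      rw [Finset.mul_sum, ← Finset.sum_add_distrib, ← Finset.sum_sub_distrib]
      exact Finset.sum_congr rfl (fun v _ => by ring)
    rw [e1, e2, E1, E2]
    linarith
  obtain ⟨D, hD0, hD1, hD2, hD3, hDe⟩ : ∃ D : ℝ, 0 ≤ D ∧ |pp s β v1 U - pp s β v1 W| ≤ D ∧
      |pp s β v2 U - pp s β v2 W| ≤ D ∧ |pp s β v3 U - pp s β v3 W| ≤ D ∧
      (D = |pp s β v1 U - pp s β v1 W| ∨ D = |pp s β v2 U - pp s β v2 W| ∨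
        D = |pp s β v3 U - pp s β v3 W|) := by
    refine ⟨max (max |pp s β v1 U - pp s β v1 W| |pp s β v2 U - pp s β v2 W|)
      |pp s β v3 U - pp s β v3 W|, by positivity, ?_, ?_, ?_, ?_⟩
    · exact (le_max_left _ _).trans (le_max_left _ _)
    · exact (le_max_right _ _).trans (le_max_left _ _)
    · exact le_max_right _ _
    · rcases max_choice (max |pp s β v1 U - pp s β v1 W| |pp s β v2 U - pp s β v2 W|)
        |pp s β v3 U - pp s β v3 W| with h1 | h1
      · rcases max_choice |pp s β v1 U - pp s β v1 W| |pp s β v2 U - pp s β v2 W| with h2 | h2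
        · left; rw [h1, h2]
        · right; left; rw [h1, h2]
      · right; right; exact h1
  have E5 : ∀ γ ∈ B, c γ * (a γ - b γ) ^ 2 ≤ C * (s * (N * K ^ N * D)) ^ 2 := by
    intro γ hγ
    have h1 : |a γ - b γ| ≤ s * (N * K ^ N * D) := by
      by_cases hne : γ = β
      · have : a γ - b γ = 0 := by
          simp only [ha, hb, hne]; rw [div_self hβU.ne', div_self hβW.ne', sub_self]
        rw [this, abs_zero]
        positivity
      · obtain ⟨n1, n2, n3, hn, e1, e2, -, -⟩ := fr.rep γ (by have := (hB γ hγ).1; omega)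
          (by have := (hB γ hγ).2; omega)
        have f1 := local_eq hs fr.q1 fr.q2 fr.q3 e1 e2 hβU
        have f2 := local_eq hs fr.q1 fr.q2 fr.q3 e1 e2 hβW
        have g1 : a γ = s ^ q (γ.1 - β.1) (γ.2 - β.2) *
            (pp s β v1 U ^ n1 * pp s β v2 U ^ n2 * pp s β v3 U ^ n3) := by
          simp only [ha]; rw [f1]; field_simp
        have g2 : b γ = s ^ q (γ.1 - β.1) (γ.2 - β.2) *
            (pp s β v1 W ^ n1 * pp s β v2 W ^ n2 * pp s β v3 W ^ n3) := by
          simp only [hb]; rw [f2]; field_simp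
        rw [g1, g2, ← mul_sub, abs_mul]
        have hz : 0 ≤ s ^ q (γ.1 - β.1) (γ.2 - β.2) := by positivity
        rw [abs_of_nonneg hz]
        apply mul_le_mul (zpow_le_of_one_le hs hs1 (q_ne hne)) _ (abs_nonneg _) hs.le
        exact prod_lip hK (pp_nonneg hs _ _ _) (pp_nonneg hs _ _ _) (pp_nonneg hs _ _ _)
          (pp_le hs hK hAU hMU fr.m1) (pp_le hs hK hAU hMU fr.m2) (pp_le hs hK hAU hMU fr.m3)
          (pp_nonneg hs _ _ _) (pp_nonneg hs _ _ _) (pp_nonneg hs _ _ _)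
          (pp_le hs hK hAW hMW fr.m1) (pp_le hs hK hAW hMW fr.m2) (pp_le hs hK hAW hMW fr.m3)
          hn hD1 hD2 hD3
    have h2 : (a γ - b γ) ^ 2 ≤ (s * (N * K ^ N * D)) ^ 2 := by
      rw [← sq_abs (a γ - b γ)]
      exact pow_le_pow_left₀ (abs_nonneg _) h1 2
    exact mul_le_mul (hcC γ hγ) h2 (sq_nonneg _) hC
  have E6 : s ^ 2 * ∑ γ ∈ B, c γ * (a γ - b γ) ^ 2 ≤
      s ^ 2 * (B.card * (C * (s * (N * K ^ N * D)) ^ 2)) := by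
    gcongr
    rw [← nsmul_eq_mul, ← Finset.sum_const]
    exact Finset.sum_le_sum E5
  have E7 : ∀ v ∈ V, (pp s β v U - pp s β v W) ^ 2 ≤
      (B.card * C * (s ^ 2 * (N * K ^ N) ^ 2)) * D ^ 2 := by
    intro v hv
    have h1 : (a v - b v) ^ 2 ≤ ∑ v ∈ V, (a v - b v) ^ 2 :=
      Finset.single_le_sum (f := fun v => (a v - b v) ^ 2) (fun _ _ => sq_nonneg _) hv
    have h2 : a v - b v = s * (pp s β v U - pp s β v W) := by
      simp only [ha, hb, pp]; field_simp
    rw [h2] at h1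
    have h3 := (h1.trans E4).trans E6
    have h4 : s ^ 2 * (pp s β v U - pp s β v W) ^ 2 ≤
        s ^ 2 * ((B.card * C * (s ^ 2 * (N * K ^ N) ^ 2)) * D ^ 2) := by
      calc _ = (s * (pp s β v U - pp s β v W)) ^ 2 := by ring
        _ ≤ _ := h3
        _ = _ := by ring
    exact le_of_mul_le_mul_left h4 (by positivity)
  have E8 : D ^ 2 ≤ (B.card * C * (s ^ 2 * (N * K ^ N) ^ 2)) * D ^ 2 := by
    rcases hDe with h1 | h1 | h1
    · have := E7 v1 fr.m1
      rwa [← sq_abs, ← h1] at this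
    · have := E7 v2 fr.m2
      rwa [← sq_abs, ← h1] at this
    · have := E7 v3 fr.m3
      rwa [← sq_abs, ← h1] at this
  have hD : D = 0 := by
    by_contra hne
    have : 0 < D ^ 2 := by positivity
    nlinarith
  rw [hD] at hD1 hD2 hD3
  have p1 : pp s β v1 U = pp s β v1 W := by
    have := abs_nonpos_iff.1 hD1; linarith
  have p2 : pp s β v2 U = pp s β v2 W := by
    have := abs_nonpos_iff.1 hD2; linarith
  have p3 : pp s β v3 U = pp s β v3 W := by
    have := abs_nonpos_iff.1 hD3; linarith
  obtain ⟨n1, n2, n3, d, -, -, hU1⟩ := coord1 hs fr (hB β hβB).1 (hB β hβB).2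
  obtain ⟨n1', n2', n3', d', -, -, hU2⟩ := coord2 hs fr (hB β hβB).1 (hB β hβB).2
  ext
  · rw [hU1 U hβU, hU1 W hβW, p1, p2, p3]
  · rw [hU2 U hβU, hU2 W hβW, p1, p2, p3]

theorem edge_bound (hs : 0 < s) (hs1 : s ≤ 1) (hK : 1 ≤ K) (fr : Frame V k N β v1 v2 v3) {U}
    (hA : AA s V U ≤ K * MM s β U) (hM : 0 < MM s β U) {γ : ℕ × ℕ} (hγ1 : γ.1 ≤ k + 1)
    (hγ2 : γ.2 ≤ k + 1) (he : (β.1 = 0 ∧ γ.1 ≠ 0) ∨ (β.2 = 0 ∧ γ.2 ≠ 0)) :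
    h s γ U ^ 2 ≤ K ^ (2 * N) * h s v3 U ^ 2 := by
  have hβ := hpos_of_MM hs hM
  obtain ⟨n1, n2, n3, hn, e1, e2, f1, f2⟩ := fr.rep γ hγ1 hγ2
  have hn3 : n3 ≠ 0 := by
    rcases he with ⟨h1, h2⟩ | ⟨h1, h2⟩
    · rw [f1 h1]; exact h2
    · rw [f2 h1]; exact h2
  have hne : γ ≠ β := by
    rintro rfl
    omega
  obtain ⟨m, rfl⟩ := Nat.exists_eq_succ_of_ne_zero hn3
  have h1 : h s γ U ≤ K ^ N * h s v3 U := by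
    rw [local_eq hs fr.q1 fr.q2 fr.q3 e1 e2 hβ, h_pp hs hβ v3]
    have h2 : pp s β v1 U ^ n1 * pp s β v2 U ^ n2 * pp s β v3 U ^ m ≤ K ^ N :=
      prod_le hK (pp_nonneg hs _ _ _) (pp_nonneg hs _ _ _) (pp_nonneg hs _ _ _)
        (pp_le hs hK hA hM fr.m1) (pp_le hs hK hA hM fr.m2) (pp_le hs hK hA hM fr.m3) (by omega)
    have h3 := zpow_le_of_one_le hs hs1 (q_ne hne)
    have p1 := pp_nonneg hs β v1 U
    have p2 := pp_nonneg hs β v2 U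
    have p3 := pp_nonneg hs β v3 U
    calc _ = s ^ q (γ.1 - β.1) (γ.2 - β.2) * h s β U *
          ((pp s β v1 U ^ n1 * pp s β v2 U ^ n2 * pp s β v3 U ^ m) * pp s β v3 U) := by
            rw [pow_succ]; ring
      _ ≤ s * h s β U * (K ^ N * pp s β v3 U) := by gcongr
      _ = _ := by ring
  calc h s γ U ^ 2 ≤ (K ^ N * h s v3 U) ^ 2 := pow_le_pow_left₀ (h_nonneg hs _ _) h1 2
    _ = _ := by ring

theorem edge_zero1 (hs : 0 < s) (hs1 : s ≤ 1) (hK : 1 ≤ K) (fr : Frame V k N β v1 v2 v3)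
    (hB : ∀ γ ∈ B, γ.1 ≤ k ∧ γ.2 ≤ k) (hcC : ∀ γ ∈ B, c γ ≤ C) (hC : 0 ≤ C)
    (hsm : B.card * C * (s ^ 2 * K ^ (2 * N)) < 1)
    (hG : ∀ U, 0 ≤ GG s V B c U) {U}
    (hAU : AA s V U ≤ K * MM s β U) (hMU : 0 < MM s β U) (hGU : GG s V B c U = 0)
    (hβ1 : β.1 = 0) : U.1 = 0 := by
  by_contra hU1
  have hβ := hpos_of_MM hs hMU
  have hU2 : U.2 ≠ 0 := by
    intro h0
    have h1 : β.2 ≠ 0 := by have := fr.nz; tauto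
    simp [h, h0, h1] at hβ
  have hv3 : 0 < h s v3 U := by
    have h1 : 0 < (U.1 : ℝ) := by exact_mod_cast pos_iff_ne_zero.2 hU1
    have h2 : 0 < (U.2 : ℝ) := by exact_mod_cast pos_iff_ne_zero.2 hU2
    unfold h; positivity
  set W : ℝ≥0 × ℝ≥0 := (0, U.2) with hW
  have hW0 : ∀ γ : ℕ × ℕ, γ.1 ≠ 0 → h s γ W = 0 := by
    intro γ hγ; simp [h, hW, hγ]
  have hW1 : ∀ γ : ℕ × ℕ, γ.1 = 0 → h s γ W = h s γ U := by
    intro γ hγ; simp [h, hW, hγ]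
  have h1 : AA s V W + h s v3 U ^ 2 ≤ AA s V U := by
    have e : ∑ v ∈ V, (if v = v3 then h s v3 U ^ 2 else 0) = h s v3 U ^ 2 := by
      rw [Finset.sum_ite_eq' V v3, if_pos fr.m3]
    unfold AA
    rw [← e, ← Finset.sum_add_distrib]
    apply Finset.sum_le_sum
    intro v hv
    by_cases h2 : v.1 = 0
    · have : v ≠ v3 := by rintro rfl; have := fr.e1 hβ1; omega
      rw [hW1 v h2, if_neg this, add_zero]
    · rw [hW0 v h2]
      split_ifs with h3
      · rw [h3]; simp
      · simp; positivity
  have h2 : ∑ γ ∈ B, c γ * MM s γ U ≤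
      ∑ γ ∈ B, c γ * MM s γ W + B.card * (C * (s ^ 2 * (K ^ (2 * N) * h s v3 U ^ 2))) := by
    rw [← nsmul_eq_mul, ← Finset.sum_const, ← Finset.sum_add_distrib]
    apply Finset.sum_le_sum
    intro γ hγ
    by_cases h2 : γ.1 = 0
    · unfold MM
      rw [hW1 γ h2]
      have : 0 ≤ C * (s ^ 2 * (K ^ (2 * N) * h s v3 U ^ 2)) := by positivity
      linarith
    · have := edge_bound hs hs1 hK fr hAU hMU (γ := γ) (by have := (hB γ hγ).1; omega)
          (by have := (hB γ hγ).2; omega) (Or.inl ⟨hβ1, h2⟩)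
      unfold MM
      rw [hW0 γ h2]
      have h3 : c γ * (s ^ 2 * h s γ U ^ 2) ≤ C * (s ^ 2 * (K ^ (2 * N) * h s v3 U ^ 2)) := by
        apply mul_le_mul (hcC γ hγ) _ (by positivity) hC
        gcongr
      simpa using h3
  have h3 := hG W
  unfold GG at h3 hGU
  have h4 : (B.card : ℝ) * (C * (s ^ 2 * (K ^ (2 * N) * h s v3 U ^ 2))) < h s v3 U ^ 2 := by
    have : 0 < h s v3 U ^ 2 := by positivity
    calc _ = (B.card * C * (s ^ 2 * K ^ (2 * N))) * h s v3 U ^ 2 := by ring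
      _ < 1 * h s v3 U ^ 2 := mul_lt_mul_of_pos_right hsm this
      _ = _ := one_mul _
  linarith

theorem edge_zero2 (hs : 0 < s) (hs1 : s ≤ 1) (hK : 1 ≤ K) (fr : Frame V k N β v1 v2 v3)
    (hB : ∀ γ ∈ B, γ.1 ≤ k ∧ γ.2 ≤ k) (hcC : ∀ γ ∈ B, c γ ≤ C) (hC : 0 ≤ C)
    (hsm : B.card * C * (s ^ 2 * K ^ (2 * N)) < 1)
    (hG : ∀ U, 0 ≤ GG s V B c U) {U}
    (hAU : AA s V U ≤ K * MM s β U) (hMU : 0 < MM s β U) (hGU : GG s V B c U = 0)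
    (hβ1 : β.2 = 0) : U.2 = 0 := by
  by_contra hU1
  have hβ := hpos_of_MM hs hMU
  have hU2 : U.1 ≠ 0 := by
    intro h0
    have h1 : β.1 ≠ 0 := by have := fr.nz; tauto
    simp [h, h0, h1] at hβ
  have hv3 : 0 < h s v3 U := by
    have h1 : 0 < (U.1 : ℝ) := by exact_mod_cast pos_iff_ne_zero.2 hU2
    have h2 : 0 < (U.2 : ℝ) := by exact_mod_cast pos_iff_ne_zero.2 hU1
    unfold h; positivity
  set W : ℝ≥0 × ℝ≥0 := (U.1, 0) with hW
  have hW0 : ∀ γ : ℕ × ℕ, γ.2 ≠ 0 → h s γ W = 0 := by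
    intro γ hγ; simp [h, hW, hγ]
  have hW1 : ∀ γ : ℕ × ℕ, γ.2 = 0 → h s γ W = h s γ U := by
    intro γ hγ; simp [h, hW, hγ]
  have h1 : AA s V W + h s v3 U ^ 2 ≤ AA s V U := by
    have e : ∑ v ∈ V, (if v = v3 then h s v3 U ^ 2 else 0) = h s v3 U ^ 2 := by
      rw [Finset.sum_ite_eq' V v3, if_pos fr.m3]
    unfold AA
    rw [← e, ← Finset.sum_add_distrib]
    apply Finset.sum_le_sum
    intro v hv
    by_cases h2 : v.2 = 0
    · have : v ≠ v3 := by rintro rfl; have := fr.e2 hβ1; omega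
      rw [hW1 v h2, if_neg this, add_zero]
    · rw [hW0 v h2]
      split_ifs with h3
      · rw [h3]; simp
      · simp; positivity
  have h2 : ∑ γ ∈ B, c γ * MM s γ U ≤
      ∑ γ ∈ B, c γ * MM s γ W + B.card * (C * (s ^ 2 * (K ^ (2 * N) * h s v3 U ^ 2))) := by
    rw [← nsmul_eq_mul, ← Finset.sum_const, ← Finset.sum_add_distrib]
    apply Finset.sum_le_sum
    intro γ hγ
    by_cases h2 : γ.2 = 0
    · unfold MM
      rw [hW1 γ h2]
      have : 0 ≤ C * (s ^ 2 * (K ^ (2 * N) * h s v3 U ^ 2)) := by positivity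
      linarith
    · have := edge_bound hs hs1 hK fr hAU hMU (γ := γ) (by have := (hB γ hγ).1; omega)
          (by have := (hB γ hγ).2; omega) (Or.inr ⟨hβ1, h2⟩)
      unfold MM
      rw [hW0 γ h2]
      have h3 : c γ * (s ^ 2 * h s γ U ^ 2) ≤ C * (s ^ 2 * (K ^ (2 * N) * h s v3 U ^ 2)) := by
        apply mul_le_mul (hcC γ hγ) _ (by positivity) hC
        gcongr
      simpa using h3
  have h3 := hG W
  unfold GG at h3 hGU
  have h4 : (B.card : ℝ) * (C * (s ^ 2 * (K ^ (2 * N) * h s v3 U ^ 2))) < h s v3 U ^ 2 := by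
    have : 0 < h s v3 U ^ 2 := by positivity
    calc _ = (B.card * C * (s ^ 2 * K ^ (2 * N))) * h s v3 U ^ 2 := by ring
      _ < 1 * h s v3 U ^ 2 := mul_lt_mul_of_pos_right hsm this
      _ = _ := one_mul _
  linarith

end zone
end FC

namespace FC
open scoped NNReal

set_option maxHeartbeats 1000000 in
theorem setup (V B : Finset (ℕ × ℕ)) (k N : ℕ)
    (hfr : ∀ β ∈ B, ∃ v1 v2 v3, Frame V k N β v1 v2 v3)
    (hB : ∀ γ ∈ B, γ.1 ≤ k ∧ γ.2 ≤ k) (hdisj : ∀ β ∈ B, β ∉ V) :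
    ∃ Λ : ℝ, ∀ s : ℝ, 0 < s → s ≤ 1 → s ^ 2 * Λ < 1 →
      ∃ (c : ℕ × ℕ → ℝ) (p : ℕ × ℕ → ℝ≥0 × ℝ≥0), (∀ U, 0 ≤ GG s V B c U) ∧
        (∀ U, GG s V B c U = 0 ↔ (AA s V U = 0 ∨ ∃ β ∈ B, U = p β)) ∧
        Set.InjOn p B ∧ ∀ β ∈ B, AA s V (p β) ≠ 0 ∧ ((p β).1 = 0 ↔ β.1 = 0) ∧
          ((p β).2 = 0 ↔ β.2 = 0) := by
  classical
  set C : ℝ := V.card + 1 with hCdef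
  have hC1 : 1 ≤ C := by simp [hCdef]
  set b : ℝ := (B.card : ℝ) with hb
  have hb0 : 0 ≤ b := by simp [hb]
  set K : ℝ := 2 * C * (b + 1) with hKdef
  have hK1 : 1 ≤ K := by nlinarith
  set L : ℝ := K ^ (2 * N) with hL
  have hL1 : 1 ≤ L := one_le_pow₀ hK1
  have hN1 : (1 : ℝ) ≤ ((N : ℝ) + 1) ^ 2 := one_le_pow₀ (by simp)
  refine ⟨2 * C * (b + 1) * ((N + 1) ^ 2) * L, ?_⟩
  intro s hs hs1 hsΛ
  -- smallness consequences
  have hs2 : 0 < s ^ 2 := by positivity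
  have hbig : s ^ 2 * (2 * C * (b + 1) * L) < 1 := by
    refine lt_of_le_of_lt ?_ hsΛ
    have : 2 * C * (b + 1) * L ≤ 2 * C * (b + 1) * ((N + 1) ^ 2) * L := by
      have h0 : 0 ≤ 2 * C * (b + 1) * L := by positivity
      nlinarith
    gcongr
  have hCbL : s ^ 2 * L * (C * (b + 1)) < 1 / 2 := by linarith
  have hsL : 0 < s ^ 2 * L := by positivity
  have hd1 : s ^ 2 * L * b < 1 := by
    have : b ≤ C * (b + 1) := by nlinarith
    nlinarith
  have hd2 : C * (s ^ 2 * L) * b ≤ 1 / 2 := by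
    have : C * b ≤ C * (b + 1) := by nlinarith
    nlinarith
  have hd3 : s ^ 2 * L < 1 := by
    have : 1 ≤ C * (b + 1) := by nlinarith
    nlinarith
  have hd4 : b * C * (s ^ 2 * L) < 1 := by linarith
  have hd5 : b * C * (s ^ 2 * (N * K ^ N) ^ 2) < 1 := by
    refine lt_of_le_of_lt ?_ hsΛ
    have e : (N * K ^ N) ^ 2 = (N : ℝ) ^ 2 * L := by rw [hL]; ring
    rw [e]
    have h1 : (N : ℝ) ^ 2 ≤ (N + 1) ^ 2 := by gcongr; linarith
    have h2 : b * C ≤ 2 * C * (b + 1) := by nlinarith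
    calc b * C * (s ^ 2 * ((N : ℝ) ^ 2 * L)) = s ^ 2 * ((b * C) * (N : ℝ) ^ 2 * L) := by ring
      _ ≤ s ^ 2 * ((2 * C * (b + 1)) * ((N : ℝ) + 1) ^ 2 * L) := by gcongr
  have hcard : (Fintype.card B : ℝ) = b := by simp [hb]
  obtain ⟨c0, hc0, hcC, hG0, hz⟩ := extremal (κ := B) (AA s V) (fun β => MM s β.1) C K (s ^ 2 * L)
    (by linarith) (AA_nonneg s V) (fun β => MM_nonneg s β.1) (by linarith)
    (by rw [hcard]; nlinarith) hsL.le (by rw [hcard]; exact hd1) (by rw [hcard]; exact hd2)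
    (by
      intro β U hA hM γ hne
      obtain ⟨v1, v2, v3, fr⟩ := hfr β.1 β.2
      have := hB γ.1 γ.2
      exact zone_a hs hs1 hK1 fr hA hM (by omega) (by omega) (fun e => hne (Subtype.ext e)))
    (by
      intro β U hA hM
      obtain ⟨v1, v2, v3, fr⟩ := hfr β.1 β.2
      exact zone_b hs fr hM)
    (by
      intro β
      obtain ⟨U, h1, h2⟩ := zone_c (V := V) hs hs1 β.1 (hdisj β.1 β.2)
      refine ⟨U, h1, lt_of_le_of_lt h2 ?_⟩
      rw [hCdef]
      have : 0 < MM s β.1 U := h1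
      nlinarith)
    (by
      intro β c hpos
      obtain ⟨v1, v2, v3, fr⟩ := hfr β.1 β.2
      have := hB β.1 β.2
      refine zone_d hs hs1 hK1 fr this.1 this.2 (fun U => AA s V U - ∑ γ : B, c γ * MM s γ.1 U) ?_ hpos
      exact (AA_cont s V).sub (continuous_finsetSum _ (fun γ _ => continuous_const.mul (MM_cont s γ.1))))
  set c : ℕ × ℕ → ℝ := fun γ => if hγ : γ ∈ B then c0 ⟨γ, hγ⟩ else 0 with hcdef
  have hGG : ∀ U, GG s V B c U = AA s V U - ∑ γ : B, c0 γ * MM s γ.1 U := by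
    intro U
    unfold GG
    rw [← Finset.sum_coe_sort B]
    congr 1
    apply Finset.sum_congr rfl
    intro γ _
    simp [hcdef]
  have hcn : ∀ γ ∈ B, 0 ≤ c γ := by
    intro γ hγ
    simp only [hcdef, dif_pos hγ]; exact hc0 _
  have hcC' : ∀ γ ∈ B, c γ ≤ C := by
    intro γ hγ
    simp only [hcdef, dif_pos hγ]; exact hcC _
  have hG : ∀ U, 0 ≤ GG s V B c U := fun U => by rw [hGG]; exact hG0 U
  have hz' : ∀ β ∈ B, ∃ U, AA s V U ≤ K * MM s β U ∧ 0 < MM s β U ∧ GG s V B c U = 0 := by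
    intro β hβ
    obtain ⟨U, h1, h2, h3⟩ := hz ⟨β, hβ⟩
    exact ⟨U, h1, h2, by rw [hGG]; exact h3⟩
  choose! p hp1 hp2 hp3 using hz'
  refine ⟨c, p, hG, ?_, ?_, ?_⟩
  · intro U
    constructor
    · intro hGU
      by_cases hA0 : AA s V U = 0
      · left; exact hA0
      right
      have hApos : 0 < AA s V U := lt_of_le_of_ne (AA_nonneg s V U) (Ne.symm hA0)
      have hex : ∃ β ∈ B, AA s V U ≤ K * MM s β U := by
        by_contra hcon
        push Not at hcon
        have h1 : ∑ γ ∈ B, c γ * MM s γ U ≤ ∑ γ ∈ B, C * (AA s V U / K) := by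
          apply Finset.sum_le_sum
          intro γ hγ
          apply mul_le_mul (hcC' γ hγ) _ (MM_nonneg _ _ _) (by linarith)
          rw [le_div_iff₀ (by linarith)]
          have := hcon γ hγ
          linarith
        rw [Finset.sum_const, nsmul_eq_mul] at h1
        have h2 : b * (C * (AA s V U / K)) ≤ 1 / 2 * AA s V U := by
          have e : b * (C * (AA s V U / K)) = (b * C * AA s V U) / K := by ring
          rw [e, div_le_iff₀ (by linarith), hKdef]
          have : 0 ≤ C * AA s V U := by positivity
          nlinarith
        unfold GG at hGU
        linarith
      obtain ⟨β, hβ, hA⟩ := hex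
      have hM : 0 < MM s β U := by
        rcases (MM_nonneg s β U).lt_or_eq with h1 | h1
        · exact h1
        · rw [← h1] at hA; linarith
      obtain ⟨v1, v2, v3, fr⟩ := hfr β hβ
      exact ⟨β, hβ, zone_uniq hs hs1 hK1 fr hB hβ hcC' (by linarith) hd5 hG hA hM hGU
        (hp1 β hβ) (hp2 β hβ) (hp3 β hβ)⟩
    · rintro (h1 | ⟨β, hβ, rfl⟩)
      · apply le_antisymm _ (hG U)
        unfold GG
        rw [h1]
        have : 0 ≤ ∑ γ ∈ B, c γ * MM s γ U :=
          Finset.sum_nonneg (fun γ hγ => mul_nonneg (hcn γ hγ) (MM_nonneg _ _ _))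
        linarith
      · exact hp3 β hβ
  · intro β hβ γ hγ he
    by_contra hne
    obtain ⟨v1, v2, v3, fr⟩ := hfr β hβ
    obtain ⟨w1, w2, w3, fr'⟩ := hfr γ hγ
    have b1 := hB β hβ
    have b2 := hB γ hγ
    have h1 := zone_a hs hs1 hK1 fr (hp1 β hβ) (hp2 β hβ) (γ := γ) (by omega) (by omega) (Ne.symm hne)
    have h2 := zone_a hs hs1 hK1 fr' (hp1 γ hγ) (hp2 γ hγ) (γ := β) (by omega) (by omega) hne
    rw [← he] at h2
    have h3 := hp2 β hβ
    have h4 := hp2 γ hγ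
    rw [← he] at h4
    change MM s γ (p β) ≤ s ^ 2 * L * MM s β (p β) at h1
    change MM s β (p β) ≤ s ^ 2 * L * MM s γ (p β) at h2
    have h5 := mul_lt_of_lt_one_left h3 hd3
    have h6 := mul_lt_of_lt_one_left h4 hd3
    linarith
  · intro β hβ
    obtain ⟨v1, v2, v3, fr⟩ := hfr β hβ
    have h1 := zone_b hs fr (hp2 β hβ)
    have h2 := hp2 β hβ
    have h3 := hpos_of_MM hs h2
    refine ⟨by linarith, ⟨?_, ?_⟩, ⟨?_, ?_⟩⟩
    · intro h4
      by_contra h5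
      simp [h, h4, h5] at h3
    · intro h4
      exact edge_zero1 hs hs1 hK1 fr hB hcC' (by linarith) hd4 hG (hp1 β hβ) h2 (hp3 β hβ) h4
    · intro h4
      by_contra h5
      simp [h, h4, h5] at h3
    · intro h4
      exact edge_zero2 hs hs1 hK1 fr hB hcC' (by linarith) hd4 hG (hp1 β hβ) h2 (hp3 β hβ) h4

end FC

namespace FC
open scoped NNReal
open Finset

/-- vertices condition -/
def VP (k : ℕ) (w : ℕ × ℕ) : Prop :=
  ((k - (w.1 + w.2)) % 3 = 0 ∧ ¬ (w.1 + w.2 = k ∧ (w.1 = 0 ∨ w.2 = 0))) ∨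
  ((k - (w.1 + w.2)) % 3 = 1 ∧ (w.1 = 0 ∨ w.2 = 0) ∧ 2 ≤ w.1 + w.2) ∨
  (w.1 = 0 ∧ w.2 = 0 ∧ k % 3 = 2)

/-- centers condition -/
def BP (k : ℕ) (w : ℕ × ℕ) : Prop :=
  (1 ≤ w.1 ∧ 1 ≤ w.2 ∧ (k - (w.1 + w.2)) % 3 ≠ 0) ∨
  ((w.1 = 0 ∨ w.2 = 0) ∧ 1 ≤ w.1 + w.2 ∧
    ((k - (w.1 + w.2)) % 3 = 2 ∨ (k % 3 = 2 ∧ w.1 + w.2 = 1)))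

instance (k : ℕ) : DecidablePred (VP k) := fun w => by unfold VP; infer_instance
instance (k : ℕ) : DecidablePred (BP k) := fun w => by unfold BP; infer_instance

def tri (k : ℕ) : Finset (ℕ × ℕ) := (range (k + 1)).biUnion (fun n => antidiagonal n)

theorem mem_tri {k : ℕ} {w : ℕ × ℕ} : w ∈ tri k ↔ w.1 + w.2 ≤ k := by
  simp [tri]

def VV (k : ℕ) : Finset (ℕ × ℕ) := (tri k).filter (VP k)
def BB (k : ℕ) : Finset (ℕ × ℕ) := (tri k).filter (BP k)

theorem mem_VV {k : ℕ} {w : ℕ × ℕ} : w ∈ VV k ↔ w.1 + w.2 ≤ k ∧ VP k w := by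
  simp [VV, mem_tri]
theorem mem_BB {k : ℕ} {w : ℕ × ℕ} : w ∈ BB k ↔ w.1 + w.2 ≤ k ∧ BP k w := by
  simp [BB, mem_tri]

theorem BV_disj {k : ℕ} : ∀ β ∈ BB k, β ∉ VV k := by
  intro β h1 h2
  rw [mem_BB] at h1
  rw [mem_VV] at h2
  unfold VP at h2
  unfold BP at h1
  omega

theorem VP_of {k a c : ℕ} (h : a + c ≤ k ∧ (((k - (a + c)) % 3 = 0 ∧ ¬ (a + c = k ∧ (a = 0 ∨ c = 0))) ∨
    ((k - (a + c)) % 3 = 1 ∧ (a = 0 ∨ c = 0) ∧ 2 ≤ a + c) ∨ (a = 0 ∧ c = 0 ∧ k % 3 = 2))) :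
    (a, c) ∈ VV k := mem_VV.2 h

theorem BP_iff {k a c : ℕ} : BP k (a, c) ↔ ((1 ≤ a ∧ 1 ≤ c ∧ (k - (a + c)) % 3 ≠ 0) ∨
  ((a = 0 ∨ c = 0) ∧ 1 ≤ a + c ∧ ((k - (a + c)) % 3 = 2 ∨ (k % 3 = 2 ∧ a + c = 1)))) := Iff.rfl

theorem q_simp (a c x y d e : ℤ) (h1 : a - x = d) (h2 : c - y = e) (h3 : q d e = 1) :
    q (a - x) (c - y) = 1 := by rw [h1, h2, h3]

theorem frames {k : ℕ} (hk : 3 ≤ k) : ∀ β ∈ BB k, ∃ v1 v2 v3,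
    Frame (VV k) k (20 * (k + 1)) β v1 v2 v3 := by
  rintro ⟨a, c⟩ hβ
  rw [mem_BB] at hβ
  obtain ⟨h1, h2⟩ := hβ
  unfold BP at h2
  simp only at h1 h2
  rcases h2 with ⟨ha, hc, hb⟩ | ⟨hac, h3, hb⟩
  · obtain ⟨a, rfl⟩ := Nat.exists_eq_add_of_le' ha
    obtain ⟨c, rfl⟩ := Nat.exists_eq_add_of_le' hc
    have : (k - (a + 1 + (c + 1))) % 3 = 1 ∨ (k - (a + 1 + (c + 1))) % 3 = 2 := by omega
    rcases this with hb1 | hb1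
    · refine ⟨(a + 1, c + 2), (a + 2, c + 1), (a, c), ?_, ?_, ?_, ?_, ?_, ?_, ?_, ?_, ?_, ?_, ?_⟩
      · apply VP_of; omega
      · apply VP_of; omega
      · apply VP_of; omega
      · exact q_simp _ _ _ _ 0 1 (by push_cast; try ring) (by push_cast; try ring) (by norm_num [q])
      · exact q_simp _ _ _ _ 1 0 (by push_cast; try ring) (by push_cast; try ring) (by norm_num [q])
      · exact q_simp _ _ _ _ (-1) (-1) (by push_cast; try ring) (by push_cast; try ring) (by norm_num [q])
      · rintro ⟨x, y⟩ hx hy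
        simp only at hx hy ⊢
        obtain ⟨n3, hn3⟩ : ∃ n, n = (a + 1 - x) + (c + 1 - y) := ⟨_, rfl⟩
        obtain ⟨n2, hn2⟩ : ∃ n, n = x + n3 - (a + 1) := ⟨_, rfl⟩
        obtain ⟨n1, hn1⟩ : ∃ n, n = y + n3 - (c + 1) := ⟨_, rfl⟩
        have e1 : x + n3 = n2 + a + 1 := by omega
        have e2 : y + n3 = n1 + c + 1 := by omega
        refine ⟨n1, n2, n3, by omega, by linarith, by linarith, by omega, by omega⟩
      · left; constructor <;> simp only <;> ring
      · intro h; simp at h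
      · intro h; simp at h
      · left; simp
    · refine ⟨(a + 1, c), (a, c + 1), (a + 2, c + 2), ?_, ?_, ?_, ?_, ?_, ?_, ?_, ?_, ?_, ?_, ?_⟩
      · apply VP_of; omega
      · apply VP_of; omega
      · apply VP_of; omega
      · exact q_simp _ _ _ _ 0 (-1) (by push_cast; try ring) (by push_cast; try ring) (by norm_num [q])
      · exact q_simp _ _ _ _ (-1) 0 (by push_cast; try ring) (by push_cast; try ring) (by norm_num [q])
      · exact q_simp _ _ _ _ 1 1 (by push_cast; try ring) (by push_cast; try ring) (by norm_num [q])
      · rintro ⟨x, y⟩ hx hy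
        simp only at hx hy ⊢
        obtain ⟨n3, hn3⟩ : ∃ n, n = (x - (a + 1)) + (y - (c + 1)) := ⟨_, rfl⟩
        obtain ⟨n2, hn2⟩ : ∃ n, n = (a + 1) + n3 - x := ⟨_, rfl⟩
        obtain ⟨n1, hn1⟩ : ∃ n, n = (c + 1) + n3 - y := ⟨_, rfl⟩
        have e1 : x + n2 = n3 + a + 1 := by omega
        have e2 : y + n1 = n3 + c + 1 := by omega
        refine ⟨n1, n2, n3, by omega, by linarith, by linarith, by omega, by omega⟩
      · left; constructor <;> simp only <;> ring
      · intro h; simp at h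
      · intro h; simp at h
      · left; simp
  · rcases hac with rfl | rfl
    · obtain ⟨c, rfl⟩ : ∃ m, c = m + 1 := ⟨c - 1, by omega⟩
      by_cases hb1 : (k - (0 + (c + 1))) % 3 = 2
      · refine ⟨(0, c), (0, c + 2), (1, c + 2), ?_, ?_, ?_, ?_, ?_, ?_, ?_, ?_, ?_, ?_, ?_⟩
        · apply VP_of; omega
        · apply VP_of; omega
        · apply VP_of; omega
        · exact q_simp _ _ _ _ 0 (-1) (by push_cast; try ring) (by push_cast; try ring) (by norm_num [q])
        · exact q_simp _ _ _ _ 0 1 (by push_cast; try ring) (by push_cast; try ring) (by norm_num [q])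
        · exact q_simp _ _ _ _ 1 1 (by push_cast; try ring) (by push_cast; try ring) (by norm_num [q])
        · rintro ⟨x, y⟩ hx hy
          simp only at hx hy ⊢
          obtain ⟨n1, hn1⟩ : ∃ n, n = c + 1 + x - y := ⟨_, rfl⟩
          obtain ⟨n2, hn2⟩ : ∃ n, n = y - (c + 1 + x) := ⟨_, rfl⟩
          have e2 : y + n1 = n2 + x + c + 1 := by omega
          refine ⟨n1, n2, x, by omega, by linarith, by linarith, by omega, by omega⟩
        · right; constructor <;> simp only <;> ring
        · intro h; rfl
        · intro h; simp at h
        · right; simp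
      · obtain ⟨hk2, hc0⟩ : k % 3 = 2 ∧ c = 0 := by omega
        subst hc0
        refine ⟨(0, 0), (0, 2), (1, 1), ?_, ?_, ?_, ?_, ?_, ?_, ?_, ?_, ?_, ?_, ?_⟩
        · apply VP_of; omega
        · apply VP_of; omega
        · apply VP_of; omega
        · exact q_simp _ _ _ _ 0 (-1) (by push_cast; try ring) (by push_cast; try ring) (by norm_num [q])
        · exact q_simp _ _ _ _ 0 1 (by push_cast; try ring) (by push_cast; try ring) (by norm_num [q])
        · exact q_simp _ _ _ _ 1 0 (by push_cast; try ring) (by push_cast; try ring) (by norm_num [q])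
        · rintro ⟨x, y⟩ hx hy
          simp only at hx hy ⊢
          obtain ⟨n1, hn1⟩ : ∃ n, n = 1 - y := ⟨_, rfl⟩
          obtain ⟨n2, hn2⟩ : ∃ n, n = y - 1 := ⟨_, rfl⟩
          have e2 : y + n1 = n2 + 1 := by omega
          refine ⟨n1, n2, x, by omega, by linarith, by linarith, by omega, by omega⟩
        · right; constructor <;> simp only
        · intro h; rfl
        · intro h; simp at h
        · right; simp
    · obtain ⟨a, rfl⟩ : ∃ m, a = m + 1 := ⟨a - 1, by omega⟩
      by_cases hb1 : (k - ((a + 1) + 0)) % 3 = 2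
      · refine ⟨(a, 0), (a + 2, 0), (a + 2, 1), ?_, ?_, ?_, ?_, ?_, ?_, ?_, ?_, ?_, ?_, ?_⟩
        · apply VP_of; omega
        · apply VP_of; omega
        · apply VP_of; omega
        · exact q_simp _ _ _ _ (-1) 0 (by push_cast; try ring) (by push_cast; try ring) (by norm_num [q])
        · exact q_simp _ _ _ _ 1 0 (by push_cast; try ring) (by push_cast; try ring) (by norm_num [q])
        · exact q_simp _ _ _ _ 1 1 (by push_cast; try ring) (by push_cast; try ring) (by norm_num [q])
        · rintro ⟨x, y⟩ hx hy
          simp only at hx hy ⊢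
          obtain ⟨n1, hn1⟩ : ∃ n, n = a + 1 + y - x := ⟨_, rfl⟩
          obtain ⟨n2, hn2⟩ : ∃ n, n = x - (a + 1 + y) := ⟨_, rfl⟩
          have e2 : x + n1 = n2 + y + a + 1 := by omega
          refine ⟨n1, n2, y, by omega, by linarith, by linarith, by omega, by omega⟩
        · right; constructor <;> simp only <;> ring
        · intro h; simp at h
        · intro h; rfl
        · left; simp
      · obtain ⟨hk2, hc0⟩ : k % 3 = 2 ∧ a = 0 := by omega
        subst hc0
        refine ⟨(0, 0), (2, 0), (1, 1), ?_, ?_, ?_, ?_, ?_, ?_, ?_, ?_, ?_, ?_, ?_⟩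
        · apply VP_of; omega
        · apply VP_of; omega
        · apply VP_of; omega
        · exact q_simp _ _ _ _ (-1) 0 (by push_cast; try ring) (by push_cast; try ring) (by norm_num [q])
        · exact q_simp _ _ _ _ 1 0 (by push_cast; try ring) (by push_cast; try ring) (by norm_num [q])
        · exact q_simp _ _ _ _ 0 1 (by push_cast; try ring) (by push_cast; try ring) (by norm_num [q])
        · rintro ⟨x, y⟩ hx hy
          simp only at hx hy ⊢
          obtain ⟨n1, hn1⟩ : ∃ n, n = 1 - x := ⟨_, rfl⟩
          obtain ⟨n2, hn2⟩ : ∃ n, n = x - 1 := ⟨_, rfl⟩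
          have e2 : x + n1 = n2 + 1 := by omega
          refine ⟨n1, n2, y, by omega, by linarith, by linarith, by omega, by omega⟩
        · right; constructor <;> simp only
        · intro h; simp at h
        · intro h; rfl
        · left; simp

def wt (w : ℕ × ℕ) : ℕ := (if w.1 = 0 then 1 else 2) * (if w.2 = 0 then 1 else 2)

def gt (r m : ℕ) : ℕ := (if (m + 1) % 3 = r then 0 else 4 * m) +
  (if m % 3 = r ∨ (r = 2 ∧ m = 0) then 4 else 0)

theorem sum_row (k r m : ℕ) (hr : k % 3 = r) (hm : m < k) :
    ∑ w ∈ antidiagonal (m + 1), (if BP k w then wt w else 0) = gt r m := by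
  rw [Finset.Nat.sum_antidiagonal_eq_sum_range_succ_mk, sum_range_succ, sum_range_succ']
  have h1 : ∀ i ∈ range m, (if BP k (i + 1, (m + 1) - (i + 1)) then
      wt (i + 1, (m + 1) - (i + 1)) else 0) = if (m + 1) % 3 = r then 0 else 4 := by
    intro i hi
    rw [mem_range] at hi
    have h2 : (BP k (i + 1, (m + 1) - (i + 1))) ↔ ¬ ((m + 1) % 3 = r) := by
      rw [BP_iff]; omega
    have h3 : wt (i + 1, (m + 1) - (i + 1)) = 4 := by
      unfold wt
      rw [if_neg (by simp), if_neg (by simp only; omega)]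
    rw [h3]
    by_cases h4 : (m + 1) % 3 = r
    · rw [if_neg (by rw [h2]; exact not_not.2 h4), if_pos h4]
    · rw [if_pos (by rw [h2]; exact h4), if_neg h4]
  rw [sum_congr rfl h1, sum_const, card_range]
  have h5 : BP k (0, m + 1 - 0) ↔ (m % 3 = r ∨ (r = 2 ∧ m = 0)) := by
    rw [BP_iff]; omega
  have h6 : BP k (m + 1, m + 1 - (m + 1)) ↔ (m % 3 = r ∨ (r = 2 ∧ m = 0)) := by
    rw [BP_iff]; omega
  have h7 : wt (0, m + 1 - 0) = 2 := by simp [wt]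
  have h8 : wt (m + 1, m + 1 - (m + 1)) = 2 := by simp [wt]
  simp only [h5, h6, h7, h8]
  unfold gt
  split_ifs <;> simp <;> omega

theorem sum_wt (k r : ℕ) (hr : k % 3 = r) : ∑ w ∈ BB k, wt w = ∑ m ∈ range k, gt r m := by
  unfold BB tri
  rw [sum_filter, sum_biUnion]
  · rw [sum_range_succ']
    have : ∑ w ∈ antidiagonal 0, (if BP k w then wt w else 0) = 0 := by
      simp [BP]
    rw [this, add_zero]
    apply sum_congr rfl
    intro m hm
    exact sum_row k r m hr (mem_range.1 hm)
  · intro x _ y _ hxy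
    rw [Function.onFun, Finset.disjoint_left]
    intro w h1 h2
    rw [HasAntidiagonal.mem_antidiagonal] at h1 h2
    omega

theorem count0 (l : ℕ) : ∑ m ∈ range (3 * l), (gt 0 m : ℤ) = 12 * l ^ 2 - 4 * l := by
  induction l with
  | zero => simp
  | succ l ih =>
    rw [show 3 * (l + 1) = 3 * l + 1 + 1 + 1 by ring, sum_range_succ, sum_range_succ,
      sum_range_succ, ih]
    have h1 : gt 0 (3 * l) = 4 * (3 * l) + 4 := by
      unfold gt; rw [if_neg (by omega), if_pos (by omega)]
    have h2 : gt 0 (3 * l + 1) = 4 * (3 * l + 1) := by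
      unfold gt; rw [if_neg (by omega), if_neg (by omega)]; try ring
    have h3 : gt 0 (3 * l + 1 + 1) = 0 := by
      unfold gt; rw [if_pos (by omega), if_neg (by omega)]
    rw [h1, h2, h3]; push_cast; ring

theorem count1 (l : ℕ) : ∑ m ∈ range (3 * l + 1), (gt 1 m : ℤ) = 12 * l ^ 2 + 4 * l := by
  induction l with
  | zero => simp [gt]
  | succ l ih =>
    rw [show 3 * (l + 1) + 1 = 3 * l + 1 + 1 + 1 + 1 by ring, sum_range_succ, sum_range_succ,
      sum_range_succ, ih]
    have h1 : gt 1 (3 * l + 1) = 4 * (3 * l + 1) + 4 := by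
      unfold gt; rw [if_neg (by omega), if_pos (by omega)]
    have h2 : gt 1 (3 * l + 1 + 1) = 4 * (3 * l + 2) := by
      unfold gt; rw [if_neg (by omega), if_neg (by omega)]; try ring
    have h3 : gt 1 (3 * l + 1 + 1 + 1) = 0 := by
      unfold gt; rw [if_pos (by omega), if_neg (by omega)]
    rw [h1, h2, h3]; push_cast; ring

theorem count2 (l : ℕ) : ∑ m ∈ range (3 * l + 2), (gt 2 m : ℤ) = 12 * l ^ 2 + 12 * l + 4 := by
  induction l with
  | zero => simp [gt, sum_range_succ]
  | succ l ih =>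
    rw [show 3 * (l + 1) + 2 = 3 * l + 2 + 1 + 1 + 1 by ring, sum_range_succ, sum_range_succ,
      sum_range_succ, ih]
    have h1 : gt 2 (3 * l + 2) = 4 * (3 * l + 2) + 4 := by
      unfold gt; rw [if_neg (by omega), if_pos (by omega)]
    have h2 : gt 2 (3 * l + 2 + 1) = 4 * (3 * l + 3) := by
      unfold gt; rw [if_neg (by omega), if_neg (by omega)]; try ring
    have h3 : gt 2 (3 * l + 2 + 1 + 1) = 0 := by
      unfold gt; rw [if_pos (by omega), if_neg (by omega)]
    rw [h1, h2, h3]; push_cast; ring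

end FC

namespace FC
open scoped NNReal
open Finset

noncomputable def mono (R : Type*) [CommSemiring R] (k : ℕ) (w : ℕ × ℕ) : MvPolynomial (Fin 3) R :=
  MvPolynomial.X 0 ^ (2 * w.1) * MvPolynomial.X 1 ^ (2 * (k - (w.1 + w.2))) * MvPolynomial.X 2 ^ (2 * w.2)

noncomputable def polyf {R : Type*} [CommSemiring R] (k : ℕ) (f : ℕ × ℕ → R) : MvPolynomial (Fin 3) R :=
  ∑ w ∈ tri k, MvPolynomial.C (f w) * mono R k w

theorem eval_polyf {R : Type*} [CommSemiring R] (k : ℕ) (f : ℕ × ℕ → R) (v : Fin 3 → R) :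
    MvPolynomial.eval v (polyf k f) =
      ∑ w ∈ tri k, f w * (v 0 ^ (2 * w.1) * v 1 ^ (2 * (k - (w.1 + w.2))) * v 2 ^ (2 * w.2)) := by
  simp [polyf, mono]

theorem hom_polyf {R : Type*} [CommSemiring R] (k : ℕ) (f : ℕ × ℕ → R) :
    (polyf k f).IsHomogeneous (2 * k) := by
  apply MvPolynomial.IsHomogeneous.sum
  intro w hw
  rw [mem_tri] at hw
  apply MvPolynomial.IsHomogeneous.C_mul
  have : 2 * k = (2 * w.1 + 2 * (k - (w.1 + w.2))) + 2 * w.2 := by omega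
  rw [this]
  unfold mono
  exact ((MvPolynomial.isHomogeneous_X_pow _ _).mul (MvPolynomial.isHomogeneous_X_pow _ _)).mul
    (MvPolynomial.isHomogeneous_X_pow _ _)

theorem eval_smul_polyf {R : Type*} [CommSemiring R] (k : ℕ) (f : ℕ × ℕ → R) (t : R) (v : Fin 3 → R) :
    MvPolynomial.eval (t • v) (polyf k f) = t ^ (2 * k) * MvPolynomial.eval v (polyf k f) := by
  rw [eval_polyf, eval_polyf, mul_sum]
  apply sum_congr rfl
  intro w hw
  rw [mem_tri] at hw
  have : 2 * k = (2 * w.1 + 2 * (k - (w.1 + w.2))) + 2 * w.2 := by omega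
  rw [this]
  simp only [Pi.smul_apply, smul_eq_mul, mul_pow, pow_add]
  ring

theorem map_polyf {R S : Type*} [CommSemiring R] [CommSemiring S] (φ : R →+* S) (k : ℕ) (f : ℕ × ℕ → R) :
    MvPolynomial.map φ (polyf k f) = polyf k (fun w => φ (f w)) := by
  simp [polyf, mono]

/-- the coefficients -/
noncomputable def cf (k : ℕ) (s : ℝ) (c : ℕ × ℕ → ℝ) (w : ℕ × ℕ) : ℝ :=
  (if w ∈ VV k then (s ^ (q w.1 w.2)) ^ 2 else 0) -
    (if w ∈ BB k then c w * (s ^ 2 * (s ^ (q w.1 w.2)) ^ 2) else 0)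

/-- evaluate on the line x1 = 0 -/
theorem eval_line {R : Type*} [CommSemiring R] (k : ℕ) (f : ℕ × ℕ → R) (x z : R) :
    MvPolynomial.eval ![x, 0, z] (polyf k f) =
      ∑ i ∈ range (k + 1), f (i, k - i) * (x ^ (2 * i) * z ^ (2 * (k - i))) := by
  rw [eval_polyf]
  have hinj : Set.InjOn (fun i : ℕ => (i, k - i)) (range (k + 1) : Set ℕ) := by
    intro a _ b _ hab
    simpa using (Prod.ext_iff.1 hab).1
  rw [← sum_image (s := range (k+1)) (g := fun i => (i, k - i)) (f := fun w : ℕ × ℕ => f w * (x ^ (2 * w.1) * z ^ (2 * w.2))) hinj]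
  symm
  apply sum_subset_zero_on_sdiff
  · intro w hw
    simp only [mem_image, mem_range] at hw
    obtain ⟨i, hi, rfl⟩ := hw
    rw [mem_tri]; simp; omega
  · intro w hw
    rw [mem_sdiff, mem_tri] at hw
    have : w.1 + w.2 < k := by
      by_contra hc
      apply hw.2
      simp only [mem_image, mem_range]
      exact ⟨w.1, by omega, Prod.ext rfl (by simp; omega)⟩
    simp [zero_pow (show 2 * (k - (w.1 + w.2)) ≠ 0 by omega)]
  · intro w hw
    simp only [mem_image, mem_range] at hw
    obtain ⟨i, hi, rfl⟩ := hw
    have : k - (i + (k - i)) = 0 := by omega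
    simp [this]

theorem eval_chart (k : ℕ) (s : ℝ) (c : ℕ × ℕ → ℝ) (x z : ℝ) :
    MvPolynomial.eval ![x, 1, z] (polyf k (cf k s c)) =
      GG s (VV k) (BB k) c (Real.nnabs x, Real.nnabs z) := by
  rw [eval_polyf]
  unfold GG AA MM cf h
  simp only [sub_mul, sum_sub_distrib, ite_mul, zero_mul]
  rw [← sum_filter, ← sum_filter]
  have h1 : (tri k).filter (· ∈ VV k) = VV k := by
    ext w; simp only [mem_filter, mem_VV, mem_tri]; tauto
  have h2 : (tri k).filter (· ∈ BB k) = BB k := by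
    ext w; simp only [mem_filter, mem_BB, mem_tri]; tauto
  rw [h1, h2]
  have key : ∀ (n : ℕ) (y : ℝ), y ^ (2 * n) = (|y| ^ n) ^ 2 := by
    intro n y
    rw [← abs_pow, sq_abs, mul_comm, pow_mul]
  congr 1
  · apply sum_congr rfl
    intro w _
    simp only [Matrix.cons_val, one_pow, key, Real.coe_nnabs]
    ring
  · apply sum_congr rfl
    intro w _
    simp only [Matrix.cons_val, one_pow, key, Real.coe_nnabs]
    ring

theorem cf_edge {k : ℕ} {s : ℝ} {c : ℕ × ℕ → ℝ} {i : ℕ} (h1 : 1 ≤ i) (h2 : i + 1 ≤ k) :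
    cf k s c (i, k - i) = (s ^ (q i (k - i : ℕ))) ^ 2 := by
  have hv : (i, k - i) ∈ VV k := VP_of (by omega)
  have hb : (i, k - i) ∉ BB k := fun h => BV_disj _ h hv
  simp [cf, hv, hb]

theorem cf_corner {k : ℕ} (hk : 3 ≤ k) {s : ℝ} {c : ℕ × ℕ → ℝ} {w : ℕ × ℕ} (h : w = (0, k) ∨ w = (k, 0)) :
    cf k s c w = 0 := by
  have hv : w ∉ VV k := by
    rw [mem_VV]; unfold VP
    rcases h with rfl | rfl <;> simp <;> omega
  have hb : w ∉ BB k := by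
    rw [mem_BB]; unfold BP
    rcases h with rfl | rfl <;> simp <;> omega
  simp [cf, hv, hb]

theorem cf_next {k : ℕ} (hk : 3 ≤ k) {s : ℝ} (hs : 0 < s) {c : ℕ × ℕ → ℝ} {w : ℕ × ℕ} (h : w = (0, k - 1) ∨ w = (k - 1, 0)) :
    cf k s c w ≠ 0 := by
  have hv : w ∈ VV k := by
    rcases h with rfl | rfl <;> exact VP_of (by omega)
  have hb : w ∉ BB k := fun h => BV_disj _ h hv
  simp [cf, hv, hb]
  positivity

theorem line_zero {k : ℕ} (hk : 3 ≤ k) {s : ℝ} (hs : 0 < s) {c : ℕ × ℕ → ℝ} (x z : ℝ) :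
    MvPolynomial.eval ![x, 0, z] (polyf k (cf k s c)) = 0 ↔ x = 0 ∨ z = 0 := by
  rw [eval_line]
  have hnn : ∀ i ∈ range (k + 1), 0 ≤ cf k s c (i, k - i) * (x ^ (2 * i) * z ^ (2 * (k - i))) := by
    intro i hi
    rw [mem_range] at hi
    have : 0 ≤ x ^ (2 * i) * z ^ (2 * (k - i)) := by
      rw [pow_mul, pow_mul]; positivity
    apply mul_nonneg _ this
    rcases Nat.eq_zero_or_pos i with rfl | h1
    · rw [cf_corner hk (by simp)]
    · rcases Nat.lt_or_ge i k with h2 | h2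
      · rw [cf_edge h1 h2]; positivity
      · have : i = k := by omega
        subst this
        rw [cf_corner hk (by simp)]
  rw [sum_eq_zero_iff_of_nonneg hnn]
  constructor
  · intro H
    have := H 1 (by rw [mem_range]; omega)
    rw [cf_edge (le_refl 1) (by omega)] at this
    have h3 : (s ^ (q (1:ℕ) (k - 1 : ℕ))) ^ 2 ≠ 0 := by positivity
    have := (mul_eq_zero.1 this).resolve_left h3
    rcases mul_eq_zero.1 this with h | h
    · left; exact eq_zero_of_pow_eq_zero h
    · right; exact eq_zero_of_pow_eq_zero h
  · intro H i hi
    rw [mem_range] at hi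
    rcases Nat.eq_zero_or_pos i with rfl | h1
    · rw [cf_corner hk (by simp)]; simp
    · rcases Nat.lt_or_ge i k with h2 | h2
      · rcases H with rfl | rfl
        · simp [zero_pow (show 2 * i ≠ 0 by omega)]
        · simp [zero_pow (show 2 * (k - i) ≠ 0 by omega)]
      · have : i = k := by omega
        subst this
        rw [cf_corner hk (by simp)]; simp

theorem AA_zero {k : ℕ} (hk : 3 ≤ k) {s : ℝ} (hs : 0 < s) (U : ℝ≥0 × ℝ≥0) :
    AA s (VV k) U = 0 ↔ U = (0, 0) ∧ k % 3 = 1 := by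
  unfold AA
  rw [sum_eq_zero_iff_of_nonneg (fun _ _ => sq_nonneg _)]
  constructor
  · intro H
    have h1 := H (0, k - 1) (VP_of (by omega))
    have h2 := H (k - 1, 0) (VP_of (by omega))
    have hp : ∀ n : ℤ, s ^ n ≠ 0 := fun n => (zpow_pos hs n).ne'
    simp [h, hp] at h1 h2
    refine ⟨Prod.ext h2.1 h1.1, ?_⟩
    by_contra hc
    have h3 := H (0, 0) (VP_of (by omega))
    simp [h, hp] at h3
  · rintro ⟨rfl, hk1⟩ w hw
    have : w ≠ (0, 0) := by
      rintro rfl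
      rw [mem_VV] at hw; unfold VP at hw; simp at hw; omega
    have : w.1 ≠ 0 ∨ w.2 ≠ 0 := by
      by_contra hc; push Not at hc; exact this (Prod.ext hc.1 hc.2)
    rcases this with h1 | h1 <;> simp [h, h1]

end FC

namespace FC
open scoped NNReal
open Finset

noncomputable def sg (u : ℝ≥0) : Finset ℝ := {(u : ℝ), -(u : ℝ)}

theorem mem_sg (u : ℝ≥0) (x : ℝ) : x ∈ sg u ↔ Real.nnabs x = u := by
  unfold sg
  rw [mem_insert, mem_singleton, ← NNReal.coe_inj, Real.coe_nnabs, abs_eq (NNReal.coe_nonneg u)]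

theorem card_sg (u : ℝ≥0) : (sg u).card = if u = 0 then 1 else 2 := by
  unfold sg
  split_ifs with hu
  · subst hu; simp
  · rw [card_pair]
    intro h
    apply hu
    have : (u : ℝ) = 0 := by linarith
    exact_mod_cast this

noncomputable def fib (U : ℝ≥0 × ℝ≥0) : Finset (ℝ × ℝ) := sg U.1 ×ˢ sg U.2

theorem mem_fib (U : ℝ≥0 × ℝ≥0) (x : ℝ × ℝ) : x ∈ fib U ↔ (Real.nnabs x.1, Real.nnabs x.2) = U := by
  unfold fib
  rw [mem_product, mem_sg, mem_sg, Prod.ext_iff]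

theorem fib_disj (T : Set (ℝ≥0 × ℝ≥0)) : T.PairwiseDisjoint fib := by
  intro U _ W _ h
  rw [Function.onFun, Finset.disjoint_left]
  intro x h1 h2
  rw [mem_fib] at h1 h2
  exact h (h1.symm.trans h2)

theorem fib_card (k : ℕ) (B : Finset (ℕ × ℕ)) (p : ℕ × ℕ → ℝ≥0 × ℝ≥0) (hinj : Set.InjOn p B)
    (h0 : ∀ β ∈ B, ((p β).1 = 0 ↔ β.1 = 0) ∧ ((p β).2 = 0 ↔ β.2 = 0)) :
    ((B.image p).biUnion fib).card = ∑ w ∈ B, wt w := by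
  rw [card_biUnion (fun x hx y hy hxy => fib_disj (B.image p : Finset _) hx hy hxy), sum_image hinj]
  apply sum_congr rfl
  intro β hβ
  unfold fib wt
  rw [card_product, card_sg, card_sg]
  simp only [h0 β hβ]

theorem mk_mem_RZ (k : ℕ) (f : ℕ × ℕ → ℝ) (v : Fin 3 → ℝ) (hv : v ≠ 0) :
    Projectivization.mk ℝ v hv ∈ RZ (polyf k f) ↔ MvPolynomial.eval v (polyf k f) = 0 := by
  unfold RZ
  rw [Set.mem_ofPred_eq]
  obtain ⟨a, ha⟩ := Projectivization.exists_smul_eq_mk_rep ℝ v hv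
  rw [← ha, Units.smul_def, eval_smul_polyf]
  simp

theorem ne1 (x z : ℝ) : (![x, 1, z] : Fin 3 → ℝ) ≠ 0 := fun h => by
  have := congrFun h 1; simp at this

theorem ne0 : (![1, 0, 0] : Fin 3 → ℝ) ≠ 0 := fun h => by
  have := congrFun h 0; simp at this

theorem ne2 : (![0, 0, 1] : Fin 3 → ℝ) ≠ 0 := fun h => by
  have := congrFun h 2; simp at this

noncomputable def io (x : ℝ × ℝ) : Projectivization ℝ (Fin 3 → ℝ) := Projectivization.mk ℝ _ (ne1 x.1 x.2)

theorem io_inj : Function.Injective io := by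
  intro x y h
  unfold io at h
  rw [Projectivization.mk_eq_mk_iff'] at h
  obtain ⟨a, ha⟩ := h
  have h0 := congrFun ha 0
  have h1 := congrFun ha 1
  have h2 := congrFun ha 2
  simp at h0 h1 h2
  subst h1
  simp at h0 h2
  exact Prod.ext h0.symm h2.symm

theorem RZ_eq {k : ℕ} (hk : 3 ≤ k) {s : ℝ} (hs : 0 < s) (c : ℕ × ℕ → ℝ) (F : Finset (ℝ × ℝ))
    (hF : ∀ x, x ∈ F ↔ GG s (VV k) (BB k) c (Real.nnabs x.1, Real.nnabs x.2) = 0) :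
    RZ (polyf k (cf k s c)) = insert (Projectivization.mk ℝ _ ne0) (insert (Projectivization.mk ℝ _ ne2)
      (io '' (F : Set (ℝ × ℝ)))) := by
  ext P
  induction P using Projectivization.ind with
  | h v hv =>
  rw [mk_mem_RZ]
  constructor
  · intro h
    by_cases h1 : v 1 = 0
    · have hv' : v = ![v 0, 0, v 2] := by
        ext i; fin_cases i <;> simp [h1]
      rw [hv', line_zero hk hs] at h
      rcases h with h | h
      · right; left
        rw [Projectivization.mk_eq_mk_iff']
        refine ⟨v 2, ?_⟩
        ext i; fin_cases i <;> simp [h1, h]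
      · left
        rw [Projectivization.mk_eq_mk_iff']
        refine ⟨v 0, ?_⟩
        ext i; fin_cases i <;> simp [h1, h]
    · right; right
      have hv' : v = v 1 • ![v 0 / v 1, 1, v 2 / v 1] := by
        ext i; fin_cases i <;> simp <;> field_simp
      rw [hv', eval_smul_polyf, eval_chart] at h
      have := (mul_eq_zero.1 h).resolve_left (pow_ne_zero _ h1)
      refine ⟨(v 0 / v 1, v 2 / v 1), (hF _).2 this, ?_⟩
      unfold io
      rw [Projectivization.mk_eq_mk_iff']
      refine ⟨(v 1)⁻¹, ?_⟩
      ext i; fin_cases i <;> simp <;> field_simp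
  · rw [← mk_mem_RZ k _ v hv]
    rintro (h | h | ⟨x, hx, h⟩)
    · rw [h, mk_mem_RZ, line_zero hk hs]; simp
    · rw [h, mk_mem_RZ, line_zero hk hs]; simp
    · rw [← h, io, mk_mem_RZ, eval_chart]
      exact (hF x).1 hx

theorem RZ_count {k : ℕ} (hk : 3 ≤ k) {s : ℝ} (hs : 0 < s) (c : ℕ × ℕ → ℝ) (F : Finset (ℝ × ℝ))
    (hF : ∀ x, x ∈ F ↔ GG s (VV k) (BB k) c (Real.nnabs x.1, Real.nnabs x.2) = 0) :
    (RZ (polyf k (cf k s c))).Finite ∧ (RZ (polyf k (cf k s c))).ncard = F.card + 2 := by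
  rw [RZ_eq hk hs c F hF]
  have hfin : (io '' (F : Set (ℝ × ℝ))).Finite := F.finite_toSet.image _
  have h2 : Projectivization.mk ℝ _ ne2 ∉ io '' (F : Set (ℝ × ℝ)) := by
    rintro ⟨x, _, h⟩
    unfold io at h
    rw [Projectivization.mk_eq_mk_iff'] at h
    obtain ⟨a, ha⟩ := h
    have h1 := congrFun ha 1
    simp at h1
  have h0 : Projectivization.mk ℝ _ ne0 ∉ insert (Projectivization.mk ℝ _ ne2) (io '' (F : Set (ℝ × ℝ))) := by
    rintro (h | ⟨x, _, h⟩)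
    · rw [Projectivization.mk_eq_mk_iff'] at h
      obtain ⟨a, ha⟩ := h
      have h1 := congrFun ha 0
      simp at h1
    · unfold io at h
      rw [Projectivization.mk_eq_mk_iff'] at h
      obtain ⟨a, ha⟩ := h
      have h1 := congrFun ha 1
      simp at h1
  refine ⟨(hfin.insert _).insert _, ?_⟩
  rw [Set.ncard_insert_of_notMem h0 (hfin.insert _), Set.ncard_insert_of_notMem h2 hfin,
    Set.ncard_image_of_injective _ io_inj, Set.ncard_coe_finset]

theorem real_part {k : ℕ} (hk : 3 ≤ k) : ∃ Λ : ℝ, ∀ s, 0 < s → s ≤ 1 → s ^ 2 * Λ < 1 → ∃ c : ℕ × ℕ → ℝ,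
    (RZ (polyf k (cf k s c))).Finite ∧
    (RZ (polyf k (cf k s c))).ncard = ∑ w ∈ BB k, wt w + (if k % 3 = 1 then 1 else 0) + 2 := by
  obtain ⟨Λ, H⟩ := setup (VV k) (BB k) k (20 * (k + 1)) (frames hk)
    (fun γ hγ => by rw [mem_BB] at hγ; omega) BV_disj
  refine ⟨Λ, fun s hs hs1 hsΛ => ?_⟩
  obtain ⟨c, p, -, hz, hinj, hp⟩ := H s hs hs1 hsΛ
  refine ⟨c, ?_⟩
  have hcard := fib_card k (BB k) p hinj (fun β hβ => (hp β hβ).2)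
  by_cases h1 : k % 3 = 1
  · have hnot : ((0, 0) : ℝ × ℝ) ∉ ((BB k).image p).biUnion fib := by
      rw [mem_biUnion]
      rintro ⟨U, hU, hm⟩
      rw [mem_fib] at hm
      rw [mem_image] at hU
      obtain ⟨β, hβ, rfl⟩ := hU
      apply (hp β hβ).1
      rw [AA_zero hk hs]
      exact ⟨by rw [← hm]; simp, h1⟩
    have := RZ_count hk hs c (insert (0, 0) (((BB k).image p).biUnion fib)) (by
      intro x
      rw [hz, AA_zero hk hs, mem_insert, mem_biUnion]
      simp only [mem_fib, mem_image, h1, and_true]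
      constructor
      · rintro (rfl | ⟨U, ⟨β, hβ, rfl⟩, hx⟩)
        · left; simp
        · right; exact ⟨β, hβ, hx⟩
      · rintro (h | ⟨β, hβ, hx⟩)
        · left
          rw [Prod.ext_iff] at h
          simp at h
          exact Prod.ext h.1 h.2
        · right; exact ⟨_, ⟨β, hβ, rfl⟩, hx⟩)
    rw [card_insert_of_notMem hnot, hcard] at this
    simpa [h1] using this
  · have := RZ_count hk hs c (((BB k).image p).biUnion fib) (by
      intro x
      rw [hz, AA_zero hk hs, mem_biUnion]
      simp only [mem_fib, mem_image, h1, and_false, false_or]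
      constructor
      · rintro ⟨U, ⟨β, hβ, rfl⟩, hx⟩
        exact ⟨β, hβ, hx⟩
      · rintro ⟨β, hβ, hx⟩
        exact ⟨_, ⟨β, hβ, rfl⟩, hx⟩)
    rw [hcard] at this
    simpa [h1] using this

end FC

namespace FC
open Finset

/-- factors of homogeneous polynomials are homogeneous, in evaluation form -/
theorem factor_hom {n : ℕ} {P D E : MvPolynomial (Fin 3) ℂ} (hP : P ≠ 0)
    (hn : ∀ t v, MvPolynomial.eval (t • v) P = t ^ n * MvPolynomial.eval v P) (h : P = D * E) :
    ∃ m : ℕ, ∀ (t : ℂ) v, MvPolynomial.eval (t • v) D = t ^ m * MvPolynomial.eval v D := by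
  classical
  let φ : MvPolynomial (Fin 3) ℂ →ₐ[ℂ] Polynomial (MvPolynomial (Fin 3) ℂ) :=
    MvPolynomial.aeval (fun i => Polynomial.C (MvPolynomial.X i) * Polynomial.X)
  have hφ : ∀ (Q : MvPolynomial (Fin 3) ℂ) (t : ℂ) (v : Fin 3 → ℂ),
      MvPolynomial.eval (t • v) Q = MvPolynomial.eval v (Polynomial.eval (MvPolynomial.C t) (φ Q)) := by
    intro Q t v
    induction Q using MvPolynomial.induction_on with
    | C a => 
      have : φ (MvPolynomial.C a) = Polynomial.C (MvPolynomial.C a) := by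
        rw [← MvPolynomial.algebraMap_eq, AlgHom.commutes]; rfl
      simp [this]
    | add p q hp hq => simp [hp, hq]
    | mul_X p i hp => 
      have : φ (MvPolynomial.X i) = Polynomial.C (MvPolynomial.X i) * Polynomial.X := by
        simp [φ]
      simp only [map_mul, hp, this, MvPolynomial.eval_X, Polynomial.eval_mul, Polynomial.eval_C, Polynomial.eval_X, MvPolynomial.eval_C, Pi.smul_apply, smul_eq_mul]
      ring
  have hev : ∀ (Q : MvPolynomial (Fin 3) ℂ), Polynomial.eval 1 (φ Q) = Q := by
    intro Q
    apply MvPolynomial.funext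
    intro v
    have := hφ Q 1 v
    rw [one_smul, MvPolynomial.C_1] at this
    exact this.symm
  have hne : ∀ Q, Q ≠ 0 → φ Q ≠ 0 := by
    intro Q hQ h0
    apply hQ
    rw [← hev Q, h0]; simp
  have hPn : φ P = Polynomial.C P * Polynomial.X ^ n := by
    have hinf : Set.Infinite (Set.range (fun t : ℂ => (MvPolynomial.C t : MvPolynomial (Fin 3) ℂ))) :=
      Set.infinite_range_of_injective (MvPolynomial.C_injective _ _)
    apply Polynomial.eq_of_infinite_eval_eq
    apply hinf.mono
    rintro _ ⟨t, rfl⟩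
    apply MvPolynomial.funext
    intro v
    rw [← hφ, hn]
    simp only [map_mul, Polynomial.eval_mul, Polynomial.eval_C, Polynomial.eval_X, Polynomial.eval_pow, map_pow, MvPolynomial.eval_C]
    ring
  have hD : D ≠ 0 := by rintro rfl; simp at h; exact hP h
  have hE : E ≠ 0 := by rintro rfl; simp at h; exact hP h
  have hmul : φ D * φ E = Polynomial.C P * Polynomial.X ^ n := by rw [← map_mul, ← h, hPn]
  have h1 : (φ D).natDegree + (φ E).natDegree = n := by
    rw [← Polynomial.natDegree_mul (hne D hD) (hne E hE), hmul, Polynomial.natDegree_C_mul_X_pow n P hP]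
  have h2 : (φ D).natTrailingDegree + (φ E).natTrailingDegree = n := by
    rw [← Polynomial.natTrailingDegree_mul (hne D hD) (hne E hE), hmul,
      Polynomial.C_mul_X_pow_eq_monomial, Polynomial.natTrailingDegree_monomial hP]
  have h3 := Polynomial.natTrailingDegree_le_natDegree (φ D)
  have h4 := Polynomial.natTrailingDegree_le_natDegree (φ E)
  have h5 : (φ D).natTrailingDegree = (φ D).natDegree := by omega
  refine ⟨(φ D).natDegree, fun t v => ?_⟩
  have hmon : φ D = Polynomial.monomial (φ D).natDegree ((φ D).coeff (φ D).natDegree) := by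
    ext1 i
    rw [Polynomial.coeff_monomial]
    split_ifs with hi
    · rw [hi]
    · rcases lt_or_gt_of_ne hi with hi | hi
      · exact Polynomial.coeff_eq_zero_of_natDegree_lt hi
      · exact Polynomial.coeff_eq_zero_of_lt_natTrailingDegree (by omega)
  have hc : (φ D).coeff (φ D).natDegree = D := by
    have := hev D
    rw [hmon] at this
    simpa using this
  rw [hφ, hmon, hc]
  simp only [Polynomial.eval_monomial, map_mul, map_pow, MvPolynomial.eval_C]
  rw [Polynomial.natDegree_monomial_eq _ hD, mul_comm]

/-- a univariate restriction -/
theorem uni (D : MvPolynomial (Fin 3) ℂ) (g : Fin 3 → Polynomial ℂ) (h : ∀ x, MvPolynomial.eval (fun i => (g i).eval x) D ≠ 0) :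
    ∃ c, ∀ x, MvPolynomial.eval (fun i => (g i).eval x) D = c := by
  have hr : ∀ x, (MvPolynomial.aeval g D : Polynomial ℂ).eval x = MvPolynomial.eval (fun i => (g i).eval x) D := by
    intro x
    clear h
    induction D using MvPolynomial.induction_on with
    | C a => simp
    | add p q hp hq => simp [hp, hq]
    | mul_X p i hp => simp [hp]
  by_cases hd : (MvPolynomial.aeval g D : Polynomial ℂ).degree = 0
  · refine ⟨(MvPolynomial.aeval g D : Polynomial ℂ).coeff 0, fun x => ?_⟩
    rw [← hr]
    conv_lhs => rw [Polynomial.eq_C_of_degree_eq_zero hd]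
    simp
  · obtain ⟨x, hx⟩ := IsAlgClosed.exists_root _ hd
    exact absurd ((hr x).symm.trans hx) (h x)

theorem line_root {m : ℕ} {D : MvPolynomial (Fin 3) ℂ} (hD : ¬ IsUnit D) (hD0 : D ≠ 0)
    (hm : ∀ (t : ℂ) v, MvPolynomial.eval (t • v) D = t ^ m * MvPolynomial.eval v D) :
    (∃ x, MvPolynomial.eval ![x, 0, 1] D = 0) ∨ MvPolynomial.eval ![1, 0, 0] D = 0 := by
  by_contra hcon
  push Not at hcon
  obtain ⟨h1, h2⟩ := hcon
  have h3 : ∀ z, MvPolynomial.eval ![1, 0, z] D ≠ 0 := by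
    intro z hz
    by_cases h0 : z = 0
    · subst h0; exact h2 hz
    · have e : (![1, 0, z] : Fin 3 → ℂ) = z • ![z⁻¹, 0, 1] := by
        ext i; fin_cases i <;> simp [h0]
      rw [e, hm] at hz
      exact h1 _ ((mul_eq_zero.1 hz).resolve_left (pow_ne_zero _ h0))
  obtain ⟨c, hc⟩ := uni D ![Polynomial.X, 0, 1] (fun x => by
    have e : (fun i => Polynomial.eval x ((![Polynomial.X, 0, 1] : Fin 3 → Polynomial ℂ) i)) = ![x, 0, 1] := by
      ext i; fin_cases i <;> simp
    rw [e]; exact h1 x)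
  obtain ⟨d, hd⟩ := uni D ![1, 0, Polynomial.X] (fun x => by
    have e : (fun i => Polynomial.eval x ((![1, 0, Polynomial.X] : Fin 3 → Polynomial ℂ) i)) = ![1, 0, x] := by
      ext i; fin_cases i <;> simp
    rw [e]; exact h3 x)
  have hc' : ∀ x, MvPolynomial.eval ![x, 0, 1] D = c := by
    intro x
    rw [← hc x]; congr 1; congr 1; ext i; fin_cases i <;> simp
  have hd' : ∀ x, MvPolynomial.eval ![1, 0, x] D = d := by
    intro x
    rw [← hd x]; congr 1; congr 1; ext i; fin_cases i <;> simp
  have hcd : c = d := by rw [← hc' 1, hd' 1]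
  have hc0 : c ≠ 0 := by rw [← hc' 0]; exact h1 0
  have e : (![1, 0, 2] : Fin 3 → ℂ) = (2:ℂ) • ![2⁻¹, 0, 1] := by
    ext i; fin_cases i <;> simp
  have h6 := hd' 2
  rw [e, hm, hc', ← hcd] at h6
  have h7 : (2:ℂ) ^ m = 1 := mul_right_cancel₀ hc0 (by rw [h6, one_mul])
  have h8 : m = 0 := by
    have : (2:ℕ) ^ m = 1 := by exact_mod_cast h7
    simpa using this
  subst h8
  apply hD
  have : D = MvPolynomial.C (MvPolynomial.eval 0 D) := by
    apply MvPolynomial.funext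
    intro v
    have := hm 0 v
    simp at this
    simp [this]
  rw [this]
  apply IsUnit.map
  rw [isUnit_iff_ne_zero]
  intro h
  rw [h] at this
  simp at this
  exact hD0 this

end FC

namespace FC
open Finset

theorem pd_same (i j l : Fin 3) (hij : i ≠ j) (hil : i ≠ l) (A B C : ℕ) (v : Fin 3 → ℂ) :
    MvPolynomial.eval v (MvPolynomial.pderiv i (MvPolynomial.X i ^ A * MvPolynomial.X j ^ B * MvPolynomial.X l ^ C)) =
      A * v i ^ (A - 1) * v j ^ B * v l ^ C := by
  simp [Derivation.leibniz, Derivation.leibniz_pow, MvPolynomial.pderiv_X_of_ne hij.symm, MvPolynomial.pderiv_X_of_ne hil.symm]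
  ring

theorem pd_twice (i j l : Fin 3) (hij : i ≠ j) (hil : i ≠ l) (A B C : ℕ) (v : Fin 3 → ℂ) :
    MvPolynomial.eval v (MvPolynomial.pderiv i (MvPolynomial.pderiv i (MvPolynomial.X i ^ A * MvPolynomial.X j ^ B * MvPolynomial.X l ^ C))) =
      A * (A - 1 : ℕ) * v i ^ (A - 2) * v j ^ B * v l ^ C := by
  simp [Derivation.leibniz, Derivation.leibniz_pow, MvPolynomial.pderiv_X_of_ne hij.symm, MvPolynomial.pderiv_X_of_ne hil.symm]
  rw [show A - 1 - 1 = A - 2 by omega]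
  ring

theorem pd_mix (i j l : Fin 3) (hij : i ≠ j) (hil : i ≠ l) (hjl : j ≠ l) (A B C : ℕ) (v : Fin 3 → ℂ) :
    MvPolynomial.eval v (MvPolynomial.pderiv i (MvPolynomial.pderiv j (MvPolynomial.X i ^ A * MvPolynomial.X j ^ B * MvPolynomial.X l ^ C))) =
      A * B * v i ^ (A - 1) * v j ^ (B - 1) * v l ^ C := by
  simp [Derivation.leibniz, Derivation.leibniz_pow, MvPolynomial.pderiv_X_of_ne hij.symm, MvPolynomial.pderiv_X_of_ne hil.symm,
    MvPolynomial.pderiv_X_of_ne hij, MvPolynomial.pderiv_X_of_ne hjl.symm]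
  ring

theorem sq_facts {P D E : MvPolynomial (Fin 3) ℂ} (h : P = D * D * E) (v : Fin 3 → ℂ)
    (hv : MvPolynomial.eval v D = 0) : MvPolynomial.eval v P = 0 ∧
    (∀ i, MvPolynomial.eval v (MvPolynomial.pderiv i P) = 0) ∧
    ∀ i j, MvPolynomial.eval v (MvPolynomial.pderiv i (MvPolynomial.pderiv j P)) =
      2 * MvPolynomial.eval v E * MvPolynomial.eval v (MvPolynomial.pderiv i D) * MvPolynomial.eval v (MvPolynomial.pderiv j D) := by
  subst h
  refine ⟨by simp [hv], fun i => ?_, fun i j => ?_⟩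
  · simp [Derivation.leibniz, hv]
  · simp [Derivation.leibniz, hv]
    ring

theorem hess_no {P D E : MvPolynomial (Fin 3) ℂ} (h : P = D * D * E) (v : Fin 3 → ℂ)
    (hv : MvPolynomial.eval v D = 0) (i j : Fin 3)
    (h1 : MvPolynomial.eval v (MvPolynomial.pderiv i (MvPolynomial.pderiv i P)) ≠ 0)
    (h2 : MvPolynomial.eval v (MvPolynomial.pderiv j (MvPolynomial.pderiv j P)) ≠ 0)
    (h3 : MvPolynomial.eval v (MvPolynomial.pderiv i (MvPolynomial.pderiv j P)) = 0) : False := by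
  obtain ⟨-, -, H⟩ := sq_facts h v hv
  rw [H] at h1 h2 h3
  apply mul_ne_zero h1 h2
  generalize MvPolynomial.eval v E = e at *
  generalize MvPolynomial.eval v (MvPolynomial.pderiv i D) = a at *
  generalize MvPolynomial.eval v (MvPolynomial.pderiv j D) = b at *
  have : 2 * e * a * a * (2 * e * b * b) = (2 * e * a * b) ^ 2 := by ring
  rw [this, h3]; simp

theorem pderiv_polyf (k : ℕ) (g : ℕ × ℕ → ℂ) (i : Fin 3) (v) : MvPolynomial.eval v (MvPolynomial.pderiv i (polyf k g)) =
    ∑ w ∈ tri k, g w * MvPolynomial.eval v (MvPolynomial.pderiv i (mono ℂ k w)) := by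
  simp [polyf, Derivation.leibniz]

theorem pderiv2_polyf (k : ℕ) (g : ℕ × ℕ → ℂ) (i j : Fin 3) (v) :
    MvPolynomial.eval v (MvPolynomial.pderiv i (MvPolynomial.pderiv j (polyf k g))) =
    ∑ w ∈ tri k, g w * MvPolynomial.eval v (MvPolynomial.pderiv i (MvPolynomial.pderiv j (mono ℂ k w))) := by
  simp [polyf, Derivation.leibniz]

theorem mono_120 (k : ℕ) (w : ℕ × ℕ) : mono ℂ k w = MvPolynomial.X 1 ^ (2 * (k - (w.1 + w.2))) * MvPolynomial.X 0 ^ (2 * w.1) * MvPolynomial.X 2 ^ (2 * w.2) := by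
  unfold mono; ring
theorem mono_210 (k : ℕ) (w : ℕ × ℕ) : mono ℂ k w = MvPolynomial.X 2 ^ (2 * w.2) * MvPolynomial.X 1 ^ (2 * (k - (w.1 + w.2))) * MvPolynomial.X 0 ^ (2 * w.1) := by
  unfold mono; ring
theorem mono_120' (k : ℕ) (w : ℕ × ℕ) : mono ℂ k w = MvPolynomial.X 1 ^ (2 * (k - (w.1 + w.2))) * MvPolynomial.X 2 ^ (2 * w.2) * MvPolynomial.X 0 ^ (2 * w.1) := by
  unfold mono; ring

theorem H00 {k : ℕ} (hk : 3 ≤ k) (g : ℕ × ℕ → ℂ) :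
    MvPolynomial.eval ![0,0,1] (MvPolynomial.pderiv 0 (MvPolynomial.pderiv 0 (polyf k g))) = 2 * g (1, k - 1) := by
  rw [pderiv2_polyf, sum_eq_single (1, k - 1)]
  · rw [mono, pd_twice _ _ _ (by decide) (by decide)]
    have : k - (1 + (k - 1)) = 0 := by omega
    simp [this, mul_comm]
  · rintro ⟨a, c⟩ hw hne
    rw [mem_tri] at hw
    rw [mono, pd_twice _ _ _ (by decide) (by decide)]
    simp only [ne_eq, Prod.mk.injEq] at hne hw ⊢
    by_cases h1 : k - (a + c) = 0
    · rcases Nat.lt_or_ge 1 a with h2 | h2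
      · simp [zero_pow (show 2 * a - 2 ≠ 0 by omega)]
      · have : a = 0 := by omega
        simp [this]
    · simp [zero_pow (show 2 * (k - (a + c)) ≠ 0 by omega)]
  · intro h; exact absurd (mem_tri.2 (by simp; omega)) h

theorem H11 {k : ℕ} (hk : 3 ≤ k) (g : ℕ × ℕ → ℂ) :
    MvPolynomial.eval ![0,0,1] (MvPolynomial.pderiv 1 (MvPolynomial.pderiv 1 (polyf k g))) = 2 * g (0, k - 1) := by
  rw [pderiv2_polyf, sum_eq_single (0, k - 1)]
  · rw [mono_120, pd_twice _ _ _ (by decide) (by decide)]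
    have : k - (0 + (k - 1)) = 1 := by omega
    simp only [this]
    simp [mul_comm]
  · rintro ⟨a, c⟩ hw hne
    rw [mem_tri] at hw
    rw [mono_120, pd_twice _ _ _ (by decide) (by decide)]
    simp only [ne_eq, Prod.mk.injEq] at hne hw ⊢
    by_cases h1 : a = 0
    · rcases Nat.lt_or_ge 1 (k - (a + c)) with h2 | h2
      · simp [zero_pow (show 2 * (k - (a + c)) - 2 ≠ 0 by omega)]
      · have : k - (a + c) = 0 := by omega
        simp [this]
    · simp [zero_pow (show 2 * a ≠ 0 by omega)]
  · intro h; exact absurd (mem_tri.2 (by simp)) h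

theorem H01 {k : ℕ} (g : ℕ × ℕ → ℂ) :
    MvPolynomial.eval ![0,0,1] (MvPolynomial.pderiv 0 (MvPolynomial.pderiv 1 (polyf k g))) = 0 := by
  rw [pderiv2_polyf]
  apply sum_eq_zero
  rintro ⟨a, c⟩ hw
  rw [mono, pd_mix _ _ _ (by decide) (by decide) (by decide)]
  simp only
  rcases Nat.eq_zero_or_pos a with h1 | h1
  · simp [h1]
  · simp [zero_pow (show 2 * a - 1 ≠ 0 by omega)]

theorem G22 {k : ℕ} (hk : 3 ≤ k) (g : ℕ × ℕ → ℂ) :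
    MvPolynomial.eval ![1,0,0] (MvPolynomial.pderiv 2 (MvPolynomial.pderiv 2 (polyf k g))) = 2 * g (k - 1, 1) := by
  rw [pderiv2_polyf, sum_eq_single (k - 1, 1)]
  · rw [mono_210, pd_twice _ _ _ (by decide) (by decide)]
    have : k - (k - 1 + 1) = 0 := by omega
    simp only [this]
    simp [mul_comm]
  · rintro ⟨a, c⟩ hw hne
    rw [mem_tri] at hw
    rw [mono_210, pd_twice _ _ _ (by decide) (by decide)]
    simp only [ne_eq, Prod.mk.injEq] at hne hw ⊢
    by_cases h1 : k - (a + c) = 0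
    · rcases Nat.lt_or_ge 1 c with h2 | h2
      · simp [zero_pow (show 2 * c - 2 ≠ 0 by omega)]
      · have : c = 0 := by omega
        simp [this]
    · simp [zero_pow (show 2 * (k - (a + c)) ≠ 0 by omega)]
  · intro h; exact absurd (mem_tri.2 (by simp; omega)) h

theorem G11 {k : ℕ} (hk : 3 ≤ k) (g : ℕ × ℕ → ℂ) :
    MvPolynomial.eval ![1,0,0] (MvPolynomial.pderiv 1 (MvPolynomial.pderiv 1 (polyf k g))) = 2 * g (k - 1, 0) := by
  rw [pderiv2_polyf, sum_eq_single (k - 1, 0)]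
  · rw [mono_120, pd_twice _ _ _ (by decide) (by decide)]
    have : k - (k - 1 + 0) = 1 := by omega
    simp only [this]
    simp [mul_comm]
  · rintro ⟨a, c⟩ hw hne
    rw [mem_tri] at hw
    rw [mono_120, pd_twice _ _ _ (by decide) (by decide)]
    simp only [ne_eq, Prod.mk.injEq] at hne hw ⊢
    by_cases h1 : c = 0
    · rcases Nat.lt_or_ge 1 (k - (a + c)) with h2 | h2
      · simp [zero_pow (show 2 * (k - (a + c)) - 2 ≠ 0 by omega)]
      · have : k - (a + c) = 0 := by omega
        simp [this]
    · simp [zero_pow (show 2 * c ≠ 0 by omega)]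
  · intro h; exact absurd (mem_tri.2 (by simp)) h

theorem G12 {k : ℕ} (g : ℕ × ℕ → ℂ) :
    MvPolynomial.eval ![1,0,0] (MvPolynomial.pderiv 1 (MvPolynomial.pderiv 2 (polyf k g))) = 0 := by
  rw [pderiv2_polyf]
  apply sum_eq_zero
  rintro ⟨a, c⟩ hw
  rw [mono_120', pd_mix _ _ _ (by decide) (by decide) (by decide)]
  simp only
  rcases Nat.eq_zero_or_pos c with h1 | h1
  · simp [h1]
  · simp [zero_pow (show 2 * c - 1 ≠ 0 by omega)]

/-- first derivative on the line -/
theorem d_line (k : ℕ) (g : ℕ × ℕ → ℂ) (x : ℂ) :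
    x * MvPolynomial.eval ![x, 0, 1] (MvPolynomial.pderiv 0 (polyf k g)) =
      2 * ∑ i ∈ range (k + 1), (i : ℂ) * (g (i, k - i) * (x ^ (2 * i))) := by
  have := eval_line k (fun w => (w.1 : ℂ) * g w) x 1
  simp only [one_pow, mul_one] at this
  simp only [← mul_assoc (_ : ℂ) (g _) _]
  rw [← this, eval_polyf, pderiv_polyf, mul_sum, mul_sum]
  apply sum_congr rfl
  rintro ⟨a, c⟩ hw
  rw [mono, pd_same _ _ _ (by decide) (by decide)]
  rcases Nat.eq_zero_or_pos a with h1 | h1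
  · simp [h1]
  · obtain ⟨n, rfl⟩ : ∃ n, a = n + 1 := ⟨a - 1, by omega⟩
    simp only [Matrix.cons_val, show 2 * (n + 1) - 1 = 2 * n + 1 by omega]
    push_cast
    ring

theorem sqfree {k : ℕ} (hk : 3 ≤ k) (g : ℕ × ℕ → ℂ) (h1 : g (1, k - 1) ≠ 0) (h2 : g (0, k - 1) ≠ 0)
    (h3 : g (k - 1, 1) ≠ 0) (h4 : g (k - 1, 0) ≠ 0)
    (h5 : ∀ x : ℂ, x ≠ 0 → ∑ i ∈ range (k + 1), (g (i, k - i) * (x ^ (2 * i))) = 0 →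
      ∑ i ∈ range (k + 1), (i : ℂ) * (g (i, k - i) * (x ^ (2 * i))) = 0 → False) :
    Squarefree (polyf k g) := by
  rintro D ⟨E, hE⟩
  by_contra hD
  have hP : polyf k g ≠ 0 := by
    intro h
    have := H00 hk g
    rw [h] at this
    simp at this
    exact h1 this
  have hD0 : D ≠ 0 := by rintro rfl; simp at hE; exact hP hE
  obtain ⟨m, hm⟩ := factor_hom hP (eval_smul_polyf k g) (hE.trans (mul_assoc _ _ _))
  rcases line_root hD hD0 hm with ⟨x, hx⟩ | hx
  · by_cases h0 : x = 0
    · subst h0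
      refine hess_no hE _ hx 0 1 ?_ ?_ (H01 g)
      · rw [H00 hk]; simpa using h1
      · rw [H11 hk]; simpa using h2
    · obtain ⟨f1, f2, -⟩ := sq_facts hE _ hx
      rw [eval_line] at f1
      have f3 := d_line k g x
      rw [f2 0] at f3
      apply h5 x h0
      · simpa using f1
      · simpa using f3.symm
  · refine hess_no hE _ hx 1 2 ?_ ?_ (G12 g)
    · rw [G11 hk]; simpa using h4
    · rw [G22 hk]; simpa using h3
end FC

namespace FC
open Finset

theorem bnd1 {s ρ : ℝ} (hs : 0 < s) (hs1 : s ≤ 1) (hρ : 1 ≤ ρ) {d : ℤ}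
    (hd : d ≤ -1 ∨ (2 ≤ d ∧ ρ * s ^ (6:ℤ) ≤ 1)) : ρ ^ d * s ^ (6 * d ^ 2) ≤ s ^ (6:ℤ) := by
  have hρ0 : 0 < ρ := by linarith
  rcases hd with hd | ⟨hd, h⟩
  · have h1 : ρ ^ d ≤ 1 := zpow_le_one_of_nonpos₀ hρ (by omega)
    have h2 : s ^ (6 * d ^ 2) ≤ s ^ (6:ℤ) := zpow_le_zpow_right_of_le_one₀ hs hs1 (by nlinarith)
    calc _ ≤ 1 * s ^ (6:ℤ) := mul_le_mul h1 h2 (zpow_pos hs _).le zero_le_one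
      _ = _ := one_mul _
  · have e : ρ ^ d * s ^ (6 * d ^ 2) = (ρ * s ^ (6:ℤ)) ^ d * s ^ (6 * d ^ 2 - 6 * d) := by
      rw [mul_zpow, ← zpow_mul, mul_assoc, ← zpow_add₀ hs.ne']
      congr 2; ring
    rw [e]
    have h1 : (ρ * s ^ (6:ℤ)) ^ d ≤ 1 := by
      obtain ⟨n, rfl⟩ := Int.eq_ofNat_of_zero_le (show 0 ≤ d by omega)
      rw [zpow_natCast]
      exact pow_le_one₀ (by positivity) h
    have h2 : s ^ (6 * d ^ 2 - 6 * d) ≤ s ^ (6:ℤ) := zpow_le_zpow_right_of_le_one₀ hs hs1 (by nlinarith)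
    calc _ ≤ 1 * s ^ (6:ℤ) := mul_le_mul h1 h2 (zpow_pos hs _).le zero_le_one
      _ = _ := one_mul _

noncomputable def tt (k : ℕ) (s r : ℝ) (i : ℤ) : ℝ := s ^ (2 * ((k:ℤ) ^ 2 - 3 * i * k + 3 * i ^ 2)) * r ^ i

theorem tt_pos {k : ℕ} {s r : ℝ} (hs : 0 < s) (hr : 0 < r) (i : ℤ) : 0 < tt k s r i := by
  unfold tt; positivity

theorem tt_shift {k : ℕ} {s r : ℝ} (hs : 0 < s) (hr : 0 < r) (M d : ℤ) :
    tt k s r (M + d) = tt k s r M * ((s ^ (12 * M - 6 * k) * r) ^ d * s ^ (6 * d ^ 2)) := by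
  unfold tt
  rw [mul_zpow, ← zpow_mul, zpow_add₀ hr.ne',
    show 2 * ((k:ℤ) ^ 2 - 3 * (M + d) * k + 3 * (M + d) ^ 2) =
      2 * ((k:ℤ) ^ 2 - 3 * M * k + 3 * M ^ 2) + (12 * M - 6 * k) * d + 6 * d ^ 2 by ring,
    zpow_add₀ hs.ne', zpow_add₀ hs.ne']
  ring

theorem dom_core {k : ℕ} {s : ℝ} (hs : 0 < s) (hs1 : s ≤ 1) (hsk : s ^ 2 * ((k + 1 : ℝ) ^ 2) < 1)
    (b : ℕ → ℂ) (t : ℕ → ℝ) (ht : ∀ i ∈ Icc 1 (k - 1), 0 < t i)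
    (hb : ∀ i ∈ Icc 1 (k - 1), ‖b i‖ = t i) (b0 : b 0 = 0) (bk : b k = 0)
    (M : ℕ) (hM : M ∈ Icc 1 (k - 1)) (e : ℤ) (he : e = 1 ∨ e = -1)
    (hdom : ∀ i ∈ Icc 1 (k - 1), i ≠ M → (i : ℤ) ≠ M + e → t i ≤ t M * s ^ (6:ℤ))
    (h1 : ∑ i ∈ range (k + 1), b i = 0) (h2 : ∑ i ∈ range (k + 1), (i : ℂ) * b i = 0) : False := by
  have hM' := hM
  rw [mem_Icc] at hM
  have htM := ht M hM'
  have hsum : ∑ i ∈ range (k + 1), ((((i : ℤ) - (M + e) : ℤ) : ℂ) * b i) = 0 := by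
    have : ∀ i ∈ range (k + 1), ((((i : ℤ) - (M + e) : ℤ) : ℂ) * b i) = (i : ℂ) * b i - ((M + e : ℤ) : ℂ) * b i := by
      intro i _; push_cast; ring
    rw [sum_congr rfl this, sum_sub_distrib, ← mul_sum, h1, h2]; simp
  have hMr : M ∈ range (k + 1) := by rw [mem_range]; omega
  rw [← add_sum_erase _ _ hMr] at hsum
  have hle : ‖∑ i ∈ (range (k + 1)).erase M, ((((i : ℤ) - (M + e) : ℤ) : ℂ) * b i)‖ ≤
      ∑ i ∈ (range (k + 1)).erase M, ((k + 1 : ℝ) * (t M * s ^ (6:ℤ))) := by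
    apply norm_sum_le_of_le
    intro i hi
    rw [mem_erase, mem_range] at hi
    have hpos : 0 ≤ (k + 1 : ℝ) * (t M * s ^ (6:ℤ)) := by positivity
    rcases Nat.eq_zero_or_pos i with rfl | hi0
    · rw [b0]; simpa using hpos
    by_cases hik : i = k
    · rw [hik, bk]; simpa using hpos
    have hmem : i ∈ Icc 1 (k - 1) := by rw [mem_Icc]; omega
    by_cases hN : (i : ℤ) = M + e
    · rw [hN]; simpa using hpos
    · rw [norm_mul, hb i hmem]
      apply mul_le_mul _ (hdom i hmem hi.1 hN) (ht i hmem).le (by positivity)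
      rw [Complex.norm_intCast]
      have : |(i : ℤ) - (M + e)| ≤ k + 1 := by
        rw [abs_le]; omega
      exact_mod_cast this
  rw [sum_const, nsmul_eq_mul, card_erase_of_mem hMr, card_range] at hle
  have hT : ‖((((M : ℤ) - (M + e) : ℤ) : ℂ) * b M)‖ = t M := by
    rw [norm_mul, hb M hM', Complex.norm_intCast]
    rcases he with rfl | rfl <;> simp
  have := eq_neg_of_add_eq_zero_left hsum
  rw [← norm_neg, ← this, hT] at hle
  have e1 : ((k + 1 - 1 : ℕ) : ℝ) = k := by simp
  rw [e1] at hle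
  have h6 : s ^ (6:ℤ) ≤ s ^ 2 := by
    have : s ^ (6:ℤ) = s ^ (6:ℕ) := by norm_cast
    rw [this]
    exact pow_le_pow_of_le_one hs.le hs1 (by norm_num)
  have hk0 : (0:ℝ) ≤ k := Nat.cast_nonneg k
  have : (k:ℝ) * ((k + 1) * (t M * s ^ (6:ℤ))) ≤ t M * (s ^ 2 * (k + 1) ^ 2) := by
    calc (k:ℝ) * ((k + 1) * (t M * s ^ (6:ℤ))) ≤ (k + 1) * ((k + 1) * (t M * s ^ 2)) := by
          gcongr; linarith
      _ = _ := by ring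
  nlinarith

theorem dom {k : ℕ} (hk : 3 ≤ k) {s : ℝ} (hs : 0 < s) (hs1 : s ≤ 1) (hsk : s ^ 2 * ((k + 1 : ℝ) ^ 2) < 1)
    (b : ℕ → ℂ) (r : ℝ) (hr : 0 < r)
    (hb : ∀ i ∈ Icc 1 (k - 1), ‖b i‖ = tt k s r i) (b0 : b 0 = 0) (bk : b k = 0)
    (h1 : ∑ i ∈ range (k + 1), b i = 0) (h2 : ∑ i ∈ range (k + 1), (i : ℂ) * b i = 0) : False := by
  obtain ⟨M, hM, hmax⟩ := exists_max_image (Icc 1 (k - 1)) (fun i : ℕ => tt k s r i) ⟨1, by rw [mem_Icc]; omega⟩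
  have hM' := mem_Icc.1 hM
  have htM := tt_pos (k := k) hs hr (M : ℤ)
  have hρ0 : 0 < s ^ (12 * (M:ℤ) - 6 * k) * r := mul_pos (zpow_pos hs _) hr
  have sh := tt_shift (k := k) hs hr (M : ℤ)
  generalize s ^ (12 * (M:ℤ) - 6 * k) * r = ρ at hρ0 sh
  rcases le_total 1 ρ with hρ | hρ
  · refine dom_core hs hs1 hsk b _ (fun i _ => tt_pos hs hr i) hb b0 bk M hM 1 (Or.inl rfl) ?_ h1 h2
    intro i hi hiM hiN
    have hi' := mem_Icc.1 hi
    have := sh ((i : ℤ) - M)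
    rw [show (M : ℤ) + ((i : ℤ) - M) = i by ring] at this
    rw [this]
    apply mul_le_mul_of_nonneg_left _ htM.le
    apply bnd1 hs hs1 hρ
    rcases Nat.lt_or_ge i M with hlt | hge
    · left; omega
    · right
      refine ⟨by omega, ?_⟩
      have h3 := hmax (M + 1) (by rw [mem_Icc]; omega)
      have h4 := sh 1
      push_cast at h3
      rw [h4] at h3
      have := le_of_mul_le_mul_left (h3.trans_eq (mul_one _).symm) htM
      simpa using this
  · refine dom_core hs hs1 hsk b _ (fun i _ => tt_pos hs hr i) hb b0 bk M hM (-1) (Or.inr rfl) ?_ h1 h2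
    intro i hi hiM hiN
    have hi' := mem_Icc.1 hi
    have := sh ((i : ℤ) - M)
    rw [show (M : ℤ) + ((i : ℤ) - M) = i by ring] at this
    rw [this]
    apply mul_le_mul_of_nonneg_left _ htM.le
    have key := bnd1 (d := (M : ℤ) - i) hs hs1 ((one_le_inv₀ hρ0).2 hρ) (by
      rcases Nat.lt_or_ge M i with hlt | hge
      · left; omega
      · right
        refine ⟨by omega, ?_⟩
        have h3 := hmax (M - 1) (by rw [mem_Icc]; omega)
        have h4 := sh (-1)
        have e : ((M - 1 : ℕ) : ℤ) = M + -1 := by omega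
        rw [e, h4] at h3
        have := le_of_mul_le_mul_left (h3.trans_eq (mul_one _).symm) htM
        simpa using this)
    rw [inv_zpow', neg_sub] at key
    rwa [show ((M:ℤ) - i) ^ 2 = (i - M) ^ 2 by ring] at key

theorem sqfree_cf {k : ℕ} (hk : 3 ≤ k) {s : ℝ} (hs : 0 < s) (hs1 : s ≤ 1) (hsk : s ^ 2 * ((k + 1 : ℝ) ^ 2) < 1)
    (c : ℕ × ℕ → ℝ) : Squarefree (MvPolynomial.map (algebraMap ℝ ℂ) (polyf k (cf k s c))) := by
  rw [map_polyf]
  have ee : ∀ i, 1 ≤ i → i + 1 ≤ k → cf k s c (i, k - i) ≠ 0 := by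
    intro i h1 h2
    rw [cf_edge h1 h2]; positivity
  apply sqfree hk
  · simpa using ee 1 (by omega) (by omega)
  · simpa using cf_next hk hs (by simp)
  · have := ee (k - 1) (by omega) (by omega)
    rw [show k - (k - 1) = 1 by omega] at this
    simpa using this
  · simpa using cf_next hk hs (by simp)
  · intro x hx h1 h2
    refine dom hk hs hs1 hsk _ (‖x‖ ^ 2) (by positivity) ?_ ?_ ?_ h1 h2
    · intro i hi
      rw [mem_Icc] at hi
      rw [cf_edge hi.1 (by omega), norm_mul]
      have e2 : q i (k - i : ℕ) = (k:ℤ) ^ 2 - 3 * i * k + 3 * i ^ 2 := by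
        unfold q
        rw [Nat.cast_sub (by omega)]; ring
      rw [e2]
      unfold tt
      congr 1
      · rw [Complex.coe_algebraMap, Complex.norm_real, Real.norm_eq_abs, abs_of_nonneg (by positivity),
          mul_comm 2, zpow_mul]
        norm_cast
      · rw [norm_pow, pow_mul]; norm_cast
    · simp [cf_corner hk]
    · simp [cf_corner hk]

theorem main (k : ℕ) (hk : 3 ≤ k) :
    ∃ P : MvPolynomial (Fin 3) ℝ, P ≠ 0 ∧ P.IsHomogeneous (2 * k) ∧
      Squarefree (MvPolynomial.map (algebraMap ℝ ℂ) P) ∧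
      (RZ P).Finite ∧
      ∀ l : ℕ,
        (k = 3 * l → (RZ P).ncard = 12 * l ^ 2 - 4 * l + 2) ∧
        (k = 3 * l + 1 → (RZ P).ncard = 12 * l ^ 2 + 4 * l + 3) ∧
        (k = 3 * l + 2 → (RZ P).ncard = 12 * l ^ 2 + 12 * l + 6) := by
  obtain ⟨Λ, H⟩ := real_part hk
  obtain ⟨s, hs, hs1, hsΛ, hsk⟩ : ∃ s : ℝ, 0 < s ∧ s ≤ 1 ∧ s ^ 2 * Λ < 1 ∧ s ^ 2 * ((k + 1 : ℝ) ^ 2) < 1 := by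
    have hL : 0 < |Λ| + (k + 1 : ℝ) ^ 2 + 1 := by positivity
    have hL1 : 1 ≤ |Λ| + (k + 1 : ℝ) ^ 2 + 1 := by
      have : 0 ≤ |Λ| + (k + 1 : ℝ) ^ 2 := by positivity
      linarith
    have hi1 : (|Λ| + (k + 1 : ℝ) ^ 2 + 1)⁻¹ ≤ 1 := inv_le_one_of_one_le₀ hL1
    have hi0 : 0 < (|Λ| + (k + 1 : ℝ) ^ 2 + 1)⁻¹ := inv_pos.2 hL
    have hm : (|Λ| + (k + 1 : ℝ) ^ 2 + 1)⁻¹ * (|Λ| + (k + 1 : ℝ) ^ 2 + 1) = 1 := inv_mul_cancel₀ hL.ne'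
    generalize (|Λ| + (k + 1 : ℝ) ^ 2 + 1)⁻¹ = u at *
    have hu : u ^ 2 ≤ u := by nlinarith
    have a1 := le_abs_self Λ
    have a2 := abs_nonneg Λ
    have a3 : (0:ℝ) ≤ (k + 1 : ℝ) ^ 2 := by positivity
    refine ⟨u, hi0, hi1, ?_, ?_⟩
    · calc u ^ 2 * Λ ≤ u ^ 2 * |Λ| := by gcongr
        _ ≤ u * |Λ| := by gcongr
        _ < 1 := by nlinarith
    · calc u ^ 2 * ((k + 1 : ℝ) ^ 2) ≤ u * ((k + 1 : ℝ) ^ 2) := by gcongr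
        _ < 1 := by nlinarith
  obtain ⟨c, hfin, hcard⟩ := H s hs hs1 hsΛ
  have hsq := sqfree_cf hk hs hs1 hsk c
  refine ⟨polyf k (cf k s c), ?_, hom_polyf _ _, hsq, hfin, fun l => ⟨?_, ?_, ?_⟩⟩
  · intro h0
    rw [h0, map_zero] at hsq
    exact not_squarefree_zero hsq
  · rintro rfl
    have e := count0 l
    rw [hcard, sum_wt (3 * l) 0 (by omega), if_neg (by omega)]
    have e' : ∑ m ∈ range (3 * l), gt 0 m + 4 * l = 12 * l ^ 2 := by zify; linarith
    omega
  · rintro rfl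
    have e := count1 l
    rw [hcard, sum_wt (3 * l + 1) 1 (by omega), if_pos (by omega)]
    have e' : ∑ m ∈ range (3 * l + 1), gt 1 m = 12 * l ^ 2 + 4 * l := by zify; linarith
    omega
  · rintro rfl
    have e := count2 l
    rw [hcard, sum_wt (3 * l + 2) 2 (by omega), if_neg (by omega)]
    have e' : ∑ m ∈ range (3 * l + 2), gt 2 m = 12 * l ^ 2 + 12 * l + 4 := by zify; linarith
    omega

end FC

theorem stmt_3 (k : ℕ) (hk : 3 ≤ k) :
    ∃ P : MvPolynomial (Fin 3) ℝ, P ≠ 0 ∧ P.IsHomogeneous (2 * k) ∧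
      Squarefree (MvPolynomial.map (algebraMap ℝ ℂ) P) ∧
      (RZ P).Finite ∧
      ∀ l : ℕ,
        (k = 3 * l → (RZ P).ncard = 12 * l ^ 2 - 4 * l + 2) ∧
        (k = 3 * l + 1 → (RZ P).ncard = 12 * l ^ 2 + 4 * l + 3) ∧
        (k = 3 * l + 2 → (RZ P).ncard = 12 * l ^ 2 + 12 * l + 6) := by
  exact FC.main k hk
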